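/- arXiv:2312.11752 — 3 statements merged into one kernel-verified Lean document; each statement's English description precedes it below -/
import Mathlib

section
/- Let γ ∈ (0,1), let F : ℝ^s × ℝ^a → ℝ^s be globally Lipschitz, let Ψ : ℝ^s × ℝ^a → ℝ^a be Lipschitz with ‖Ψ(s,a)‖₂ ≤ C for all (s,a), and let r : ℝ^s → [0,1] be continuous. Fix an initial condition (s₀,a₀) and suppose the Q-function Q^Ψ : ℝ^s × ℝ^a → ℝ is differentiable at (s₀,a₀), with partial gradients ∇_s Q^Ψ(s₀,a₀) ∈ ℝ^s and ∇_a Q^Ψ(s₀,a₀) ∈ ℝ^a. Then the deterministic continuous-time Bellman identity holds: log(γ⁻¹) · Q^Ψ(s₀,a₀) = r(s₀) + ⟨∇_s Q^Ψ(s₀,a₀), F(s₀,a₀)⟩ + ⟨∇_a Q^Ψ(s₀,a₀), Ψ(s₀,a₀)⟩. -/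
open MeasureTheory Real Set RealInnerProductSpace

/-- Deterministic continuous-time Bellman identity: with continuous
reward `r : ℝˢ → [0,1]`, `Q` the discounted-reward value function of the joint dynamics
`ṡ = F(s,a)`, `ȧ = Ψ(s,a)`, if `Q` is differentiable at `(s₀,a₀)` then
`log(γ⁻¹)·Q(s₀,a₀) = r(s₀) + ⟨∇ₛQ(s₀,a₀), F(s₀,a₀)⟩ + ⟨∇ₐQ(s₀,a₀), Ψ(s₀,a₀)⟩`. -/
theorem qsm_stmt3 {ns na : ℕ} (γ C : ℝ) (hγ : γ ∈ Set.Ioo (0:ℝ) 1)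
    (F : EuclideanSpace ℝ (Fin ns) → EuclideanSpace ℝ (Fin na) → EuclideanSpace ℝ (Fin ns))
    (Ψ : EuclideanSpace ℝ (Fin ns) → EuclideanSpace ℝ (Fin na) → EuclideanSpace ℝ (Fin na))
    (hF : ∃ K : NNReal, LipschitzWith K
      (fun p : EuclideanSpace ℝ (Fin ns) × EuclideanSpace ℝ (Fin na) => F p.1 p.2))
    (hΨlip : ∃ K : NNReal, LipschitzWith K
      (fun p : EuclideanSpace ℝ (Fin ns) × EuclideanSpace ℝ (Fin na) => Ψ p.1 p.2))
    (hΨbdd : ∀ s a, ‖Ψ s a‖ ≤ C)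
    (r : EuclideanSpace ℝ (Fin ns) → ℝ)
    (hrcont : Continuous r) (hr01 : ∀ x, r x ∈ Set.Icc (0:ℝ) 1)
    -- the global solution map of the joint dynamics
    (st : EuclideanSpace ℝ (Fin ns) → EuclideanSpace ℝ (Fin na) → ℝ →
      EuclideanSpace ℝ (Fin ns))
    (ac : EuclideanSpace ℝ (Fin ns) → EuclideanSpace ℝ (Fin na) → ℝ →
      EuclideanSpace ℝ (Fin na))
    (hinit : ∀ s₀ a₀, st s₀ a₀ 0 = s₀ ∧ ac s₀ a₀ 0 = a₀)
    (hODE : ∀ s₀ a₀, ∀ t : ℝ, 0 ≤ t →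
      HasDerivAt (st s₀ a₀) (F (st s₀ a₀ t) (ac s₀ a₀ t)) t ∧
      HasDerivAt (ac s₀ a₀) (Ψ (st s₀ a₀ t) (ac s₀ a₀ t)) t)
    -- uniqueness of the solution
    (huniq : ∀ s₀ a₀ (y : ℝ → EuclideanSpace ℝ (Fin ns))
      (z : ℝ → EuclideanSpace ℝ (Fin na)), y 0 = s₀ → z 0 = a₀ →
      (∀ t : ℝ, 0 ≤ t →
        HasDerivAt y (F (y t) (z t)) t ∧ HasDerivAt z (Ψ (y t) (z t)) t) →
      ∀ t : ℝ, 0 ≤ t → y t = st s₀ a₀ t ∧ z t = ac s₀ a₀ t)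
    -- the Q-function
    (Q : EuclideanSpace ℝ (Fin ns) → EuclideanSpace ℝ (Fin na) → ℝ)
    (hQ : ∀ s₀ a₀, Q s₀ a₀ = ∫ t in Set.Ioi (0:ℝ), γ ^ t * r (st s₀ a₀ t))
    -- a fixed initial condition at which `Q` is differentiable
    (s₀ : EuclideanSpace ℝ (Fin ns)) (a₀ : EuclideanSpace ℝ (Fin na))
    (hQdiff : DifferentiableAt ℝ
      (fun p : EuclideanSpace ℝ (Fin ns) × EuclideanSpace ℝ (Fin na) => Q p.1 p.2)
      (s₀, a₀)) :
    Real.log γ⁻¹ * Q s₀ a₀ =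
      r s₀ + ⟪gradient (fun s' => Q s' a₀) s₀, F s₀ a₀⟫
           + ⟪gradient (fun a' => Q s₀ a') a₀, Ψ s₀ a₀⟫ := by
  obtain ⟨hγ0, hγ1⟩ := hγ
  -- semigroup property
  have hsemi : ∀ h : ℝ, 0 ≤ h → ∀ t : ℝ, 0 ≤ t →
      st (st s₀ a₀ h) (ac s₀ a₀ h) t = st s₀ a₀ (t + h) := by
    intro h hh t ht
    refine ((huniq (st s₀ a₀ h) (ac s₀ a₀ h) (fun u => st s₀ a₀ (u + h))
      (fun u => ac s₀ a₀ (u + h)) (by simp) (by simp) ?_ t ht).1).symm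
    intro u hu
    have := hODE s₀ a₀ (u + h) (by linarith)
    exact ⟨this.1.comp_add_const u h, this.2.comp_add_const u h⟩
  set g : ℝ → ℝ := fun t => γ ^ t * r (st s₀ a₀ (max t 0)) with hg
  have hpow : Continuous (fun t : ℝ => γ ^ t) := Real.continuous_const_rpow hγ0.ne'
  have hstc : Continuous (fun t : ℝ => st s₀ a₀ (max t 0)) := by
    rw [continuous_iff_continuousAt]
    intro t
    have h1 : ContinuousAt (st s₀ a₀) (max t 0) :=
      (hODE s₀ a₀ (max t 0) (le_max_right _ _)).1.continuousAt
    exact ContinuousAt.comp (f := fun t : ℝ => max t 0) h1 (by fun_prop)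
  have hgc : Continuous g := hpow.mul (hrcont.comp hstc)
  have hlog : Real.log γ < 0 := Real.log_neg hγ0 hγ1
  have hpowint : IntegrableOn (fun t : ℝ => γ ^ t) (Ioi 0) := by
    have := integrableOn_exp_mul_Ioi hlog 0
    refine this.congr_fun (fun t _ => ?_) measurableSet_Ioi
    simp only [Real.rpow_def_of_pos hγ0]
  have hgint : IntegrableOn g (Ioi 0) := by
    refine Integrable.mono' hpowint hgc.aestronglyMeasurable (Filter.Eventually.of_forall ?_)
    intro t
    have h1 := hr01 (st s₀ a₀ (max t 0))
    have h2 : 0 < γ ^ t := Real.rpow_pos_of_pos hγ0 t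
    rw [hg, Real.norm_eq_abs, abs_of_nonneg (mul_nonneg h2.le h1.1)]
    exact mul_le_of_le_one_right h2.le h1.2
  have hQ0 : Q s₀ a₀ = ∫ t in Ioi (0:ℝ), g t := by
    rw [hQ]
    refine setIntegral_congr_fun measurableSet_Ioi (fun t ht => ?_)
    simp only [hg, max_eq_left (le_of_lt (mem_Ioi.1 ht))]
  have hkey : ∀ h : ℝ, 0 ≤ h → Q (st s₀ a₀ h) (ac s₀ a₀ h) =
      γ ^ (-h) * (Q s₀ a₀ - ∫ t in (0:ℝ)..h, g t) := by
    intro h hh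
    have e1 : (∫ t in (0:ℝ)..h, g t) + ∫ t in Ioi h, g t = ∫ t in Ioi (0:ℝ), g t :=
      intervalIntegral.integral_interval_add_Ioi hgint (hgint.mono_set (Ioi_subset_Ioi hh))
    have e2 : Q s₀ a₀ - ∫ t in (0:ℝ)..h, g t = ∫ t in Ioi h, g t := by
      rw [hQ0, ← e1]; ring
    have e3 : ∫ t in Ioi h, g t = ∫ t in Ioi (0:ℝ), g (t + h) := by
      have := (measurePreserving_add_right (volume : Measure ℝ) h).setIntegral_preimage_emb
        (measurableEmbedding_addRight h) g (Ioi h)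
      rw [← this]
      simp
    rw [e2, e3, hQ, ← integral_const_mul]
    refine setIntegral_congr_fun measurableSet_Ioi (fun t ht => ?_)
    have ht' : 0 ≤ t := le_of_lt ht
    simp only [hg]
    rw [hsemi h hh t ht', max_eq_left (by linarith), ← mul_assoc, ← Real.rpow_add hγ0]
    congr 2
    ring
  have hR : HasDerivAt (fun h : ℝ => γ ^ (-h) * (Q s₀ a₀ - ∫ t in (0:ℝ)..h, g t))
      (-Real.log γ * Q s₀ a₀ - r s₀) 0 := by
    have d1 : HasDerivAt (fun h : ℝ => ∫ t in (0:ℝ)..h, g t) (g 0) 0 :=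
      intervalIntegral.integral_hasDerivAt_right (by simp)
        (hgc.stronglyMeasurableAtFilter _ _) hgc.continuousAt
    have d2 : HasDerivAt (fun h : ℝ => γ ^ (-h)) _ 0 :=
      (hasDerivAt_neg (0:ℝ)).const_rpow hγ0
    have d3 := d2.mul (d1.const_sub (Q s₀ a₀))
    refine d3.congr_deriv ?_
    simp [hg, (hinit s₀ a₀).1]
    ring
  obtain ⟨hs0, ha0⟩ := hinit s₀ a₀
  set L := fderiv ℝ (fun p : EuclideanSpace ℝ (Fin ns) × EuclideanSpace ℝ (Fin na) =>
    Q p.1 p.2) (s₀, a₀) with hL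
  have hLd := hQdiff.hasFDerivAt
  rw [← hL] at hLd
  have hx : HasDerivAt (fun h => (st s₀ a₀ h, ac s₀ a₀ h)) (F s₀ a₀, Ψ s₀ a₀) 0 := by
    have := hODE s₀ a₀ 0 le_rfl
    rw [hs0, ha0] at this
    exact this.1.prodMk this.2
  have hC : HasDerivAt (fun h => Q (st s₀ a₀ h) (ac s₀ a₀ h)) (L (F s₀ a₀, Ψ s₀ a₀)) 0 := by
    have hLd' : HasFDerivAt (fun p : EuclideanSpace ℝ (Fin ns) × EuclideanSpace ℝ (Fin na) =>
      Q p.1 p.2) L (st s₀ a₀ 0, ac s₀ a₀ 0) := by rw [hs0, ha0]; exact hLd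
    exact hLd'.comp_hasDerivAt (f := fun h => (st s₀ a₀ h, ac s₀ a₀ h)) 0 hx
  have hEq : L (F s₀ a₀, Ψ s₀ a₀) = -Real.log γ * Q s₀ a₀ - r s₀ := by
    have h1 := hC.hasDerivWithinAt (s := Ici 0)
    have h2 := (hR.hasDerivWithinAt (s := Ici 0)).congr (fun h hh => hkey h hh)
      (hkey 0 le_rfl)
    exact (uniqueDiffWithinAt_Ici (0:ℝ)).eq_deriv _ h1 h2
  have g1 : HasFDerivAt (fun s' => Q s' a₀)
      (L.comp (ContinuousLinearMap.inl ℝ _ _)) s₀ :=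
    HasFDerivAt.comp (f := fun s' => (s', a₀)) s₀ hLd (hasFDerivAt_prodMk_left s₀ a₀)
  have g2 : HasFDerivAt (fun a' => Q s₀ a')
      (L.comp (ContinuousLinearMap.inr ℝ _ _)) a₀ :=
    HasFDerivAt.comp (f := fun a' => (s₀, a')) a₀ hLd (hasFDerivAt_prodMk_right s₀ a₀)
  have i1 : ⟪gradient (fun s' => Q s' a₀) s₀, F s₀ a₀⟫ = L (F s₀ a₀, 0) := by
    rw [gradient, InnerProductSpace.toDual_symm_apply, g1.fderiv]; simp
  have i2 : ⟪gradient (fun a' => Q s₀ a') a₀, Ψ s₀ a₀⟫ = L (0, Ψ s₀ a₀) := by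
    rw [gradient, InnerProductSpace.toDual_symm_apply, g2.fderiv]; simp
  have i3 : L (F s₀ a₀, Ψ s₀ a₀) = L (F s₀ a₀, 0) + L (0, Ψ s₀ a₀) := by
    rw [← map_add]; simp
  rw [i1, i2, add_assoc, ← i3, hEq, Real.log_inv]
  ring
end

section
/- Let γ ∈ (0,1), C > 0, let F : ℝ^s × ℝ^a → ℝ^s be globally Lipschitz, and let r : ℝ^s → [0,1] be smooth. Consider the class 𝒜 of smooth vector fields Ψ : ℝ^s × ℝ^a → ℝ^a that are Lipschitz and satisfy ‖Ψ(s,a)‖₂ ≤ C for all (s,a). Suppose Ψ* ∈ 𝒜 maximizes the objective J(Ψ) = Q^Ψ(𝟎,𝟎) over 𝒜, and suppose Q^{Ψ*} is differentiable along the trajectory (s(t,𝟎,𝟎), a(t,𝟎,𝟎)) of the Ψ*-dynamics started at the origin. Then for every t ≥ 0, writing (s,a) = (s(t,𝟎,𝟎), a(t,𝟎,𝟎)), if ∇_a Q^{Ψ*}(s,a) ≠ 𝟎 then there exists α_{s,a} > 0 such that Ψ*(s,a) = α_{s,a} · ∇_a Q^{Ψ*}(s,a). -/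
open MeasureTheory Real Set

/-- The admissible class `𝒜`: smooth vector fields `Ψ : ℝˢ × ℝᵃ → ℝᵃ` that are
Lipschitz and uniformly bounded in norm by `C`. -/
def QSM.Admissible {ns na : ℕ} (C : ℝ)
    (Ψ : EuclideanSpace ℝ (Fin ns) → EuclideanSpace ℝ (Fin na) →
      EuclideanSpace ℝ (Fin na)) : Prop :=
  ContDiff ℝ (⊤ : ℕ∞) (fun p : EuclideanSpace ℝ (Fin ns) × EuclideanSpace ℝ (Fin na) =>
      Ψ p.1 p.2) ∧
  (∃ K : NNReal, LipschitzWith K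
    (fun p : EuclideanSpace ℝ (Fin ns) × EuclideanSpace ℝ (Fin na) => Ψ p.1 p.2)) ∧
  ∀ s a, ‖Ψ s a‖ ≤ C

structure QSM.IsFlow {E : Type*} [NormedAddCommGroup E] [NormedSpace ℝ E]
    (V : E → E) (y : E → ℝ → E) : Prop where
  init : ∀ p, y p 0 = p
  cont : ∀ p, Continuous (y p)
  der : ∀ p t, 0 ≤ t → HasDerivWithinAt (y p) (V (y p t)) (Ici t) t

section flows
variable {E : Type*} [NormedAddCommGroup E] [NormedSpace ℝ E]

theorem QSM.flow_unique {V : E → E} {K : NNReal} (hV : LipschitzWith K V) {f g : ℝ → E}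
    {T : ℝ} (hf : Continuous f) (hg : Continuous g)
    (hf' : ∀ t ∈ Ico 0 T, HasDerivWithinAt f (V (f t)) (Ici t) t)
    (hg' : ∀ t ∈ Ico 0 T, HasDerivWithinAt g (V (g t)) (Ici t) t) (h0 : f 0 = g 0) :
    ∀ t ∈ Icc 0 T, f t = g t :=
  ODE_solution_unique_of_mem_Icc_right (v := fun _ => V) (s := fun _ => univ) (K := K)
    (fun _ _ => hV.lipschitzOnWith) hf.continuousOn hf' (fun _ _ => mem_univ _)
    hg.continuousOn hg' (fun _ _ => mem_univ _) h0

theorem QSM.IsFlow.shift {V : E → E} {y : E → ℝ → E} (hy : QSM.IsFlow V y) (p : E) {t : ℝ}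
    (ht : 0 ≤ t) (u : ℝ) (hu : 0 ≤ u) :
    HasDerivWithinAt (fun u => y p (t + u)) (V (y p (t + u))) (Ici u) u := by
  have h1 := hy.der p (t + u) (by linarith)
  have h2 : HasDerivWithinAt (fun u : ℝ => t + u) 1 (Ici u) u :=
    ((hasDerivAt_id u).const_add t).hasDerivWithinAt
  have h3 := HasDerivWithinAt.scomp u h1 h2 (fun v hv => by
    simp only [mem_Ici] at hv ⊢; linarith)
  simpa [Function.comp_def] using h3

theorem QSM.IsFlow.semigroup {V : E → E} {y : E → ℝ → E} {K : NNReal} (hV : LipschitzWith K V)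
    (hy : QSM.IsFlow V y) (p : E) {t u : ℝ} (ht : 0 ≤ t) (hu : 0 ≤ u) :
    y (y p t) u = y p (t + u) := by
  refine QSM.flow_unique hV (T := u) (f := y (y p t)) (g := fun u => y p (t + u))
    (hy.cont _) ((hy.cont p).comp (by fun_prop)) (fun v hv => hy.der _ v hv.1)
    (fun v hv => hy.shift p ht v hv.1) (by simp [hy.init]) u ⟨hu, le_rfl⟩

theorem QSM.IsFlow.eq_of_agree {V W : E → E} {y z : E → ℝ → E} {K : NNReal}
    (hV : LipschitzWith K V) (hy : QSM.IsFlow W y) (hz : QSM.IsFlow V z) (p : E) {T : ℝ}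
    (h : ∀ u ∈ Ico 0 T, W (y p u) = V (y p u)) : ∀ u ∈ Icc 0 T, y p u = z p u := by
  refine QSM.flow_unique hV (hy.cont p) (hz.cont p) (fun u hu => ?_)
    (fun u hu => hz.der p u hu.1) (by simp [hy.init, hz.init])
  rw [← h u hu]; exact hy.der p u hu.1

/-- mean value -/
theorem QSM.IsFlow.mv {V : E → E} {y : E → ℝ → E} (hy : QSM.IsFlow V y) (p c : E) {S u v : ℝ}
    (hu : 0 ≤ u) (huv : u ≤ v) (hb : ∀ w ∈ Icc u v, ‖V (y p w) - c‖ ≤ S) :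
    ‖y p v - y p u - (v - u) • c‖ ≤ S * (v - u) := by
  have h := norm_image_sub_le_of_norm_deriv_right_le_segment
    (f := fun w => y p w - w • c) (f' := fun w => V (y p w) - c) (a := u) (b := v) (C := S)
    (((hy.cont p).sub (by fun_prop)).continuousOn)
    (fun w hw => by
      have := (hy.der p w (hu.trans hw.1)).sub
        (((hasDerivAt_id w).smul_const c).hasDerivWithinAt (s := Ici w))
      simp only [one_smul] at this
      exact this)
    (fun w hw => hb w ⟨hw.1, hw.2.le⟩) v ⟨huv, le_rfl⟩
  convert h using 2
  simp only [sub_smul]; abel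

/-- a priori bound on a short window -/
theorem QSM.IsFlow.apriori {V : E → E} {y : E → ℝ → E} (hy : QSM.IsFlow V y) (p q : E)
    {L k h u₀ : ℝ} (hL : 0 ≤ L) (hk : 0 ≤ k) (hLh : L * h ≤ 1 / 2)
    (hu₀ : u₀ ∈ Icc 0 h)
    (hb : ∀ w ∈ Icc 0 h, ‖V (y p w)‖ ≤ L * ‖y p w - q‖ + k) :
    ∀ u ∈ Icc 0 h, ‖y p u - q‖ ≤ 2 * ‖y p u₀ - q‖ + 2 * h * k := by
  have hh : 0 ≤ h := hu₀.1.trans hu₀.2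
  obtain ⟨m, hm, hmax⟩ := isCompact_Icc.exists_isMaxOn (⟨0, by simp [hh]⟩ : (Icc 0 h).Nonempty)
    (((hy.cont p).sub (continuous_const (y := q))).norm.continuousOn (s := Icc 0 h))
  set Δ := ‖y p m - q‖ with hΔ
  have hmax' : ∀ u ∈ Icc 0 h, ‖y p u - q‖ ≤ Δ := fun u hu => hmax hu
  have hS : ∀ w ∈ Icc 0 h, ‖V (y p w) - 0‖ ≤ L * Δ + k := fun w hw => by
    rw [sub_zero]
    exact (hb w hw).trans (by gcongr; exact hmax' w hw)
  have hSn : 0 ≤ L * Δ + k := by positivity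
  have hdist : ‖y p m - y p u₀‖ ≤ (L * Δ + k) * h := by
    rcases le_total u₀ m with hc | hc
    · have := hy.mv p 0 hu₀.1 hc (fun w hw => hS w ⟨hu₀.1.trans hw.1, hw.2.trans hm.2⟩)
      simp only [smul_zero, sub_zero] at this
      refine this.trans ?_
      gcongr; linarith [hm.2, hu₀.1]
    · have := hy.mv p 0 hm.1 hc (fun w hw => hS w ⟨hm.1.trans hw.1, hw.2.trans hu₀.2⟩)
      simp only [smul_zero, sub_zero] at this
      rw [norm_sub_rev]
      refine this.trans ?_
      gcongr; linarith [hm.1, hu₀.2]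
  have h1 : Δ ≤ ‖y p u₀ - q‖ + (L * Δ + k) * h := by
    calc Δ = ‖(y p m - y p u₀) + (y p u₀ - q)‖ := by rw [hΔ]; congr 1; abel
      _ ≤ _ := norm_add_le _ _
      _ ≤ _ := by linarith
  have h2 : (L * h) * Δ ≤ 1 / 2 * Δ := by gcongr
  intro u hu
  have := hmax' u hu
  nlinarith

/-- comparison on a short window -/
theorem QSM.IsFlow.compare {V W : E → E} {y z : E → ℝ → E} {K : NNReal}
    (hV : LipschitzWith K V) (hy : QSM.IsFlow W y) (hz : QSM.IsFlow V z) (p : E) {C h : ℝ}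
    (hC : 0 ≤ C) (hh : 0 ≤ h) (hKh : K * h ≤ 1 / 2) {η : E → ℝ} (hη : Continuous η)
    (hη0 : ∀ q, 0 ≤ η q) (hWV : ∀ q, ‖W q - V q‖ ≤ 2 * C * η q) :
    ∀ u ∈ Icc 0 h, ‖y p u - z p u‖ ≤ 4 * C * ∫ v in (0:ℝ)..h, η (y p v) := by
  obtain ⟨m, hm, hmax⟩ := isCompact_Icc.exists_isMaxOn (⟨0, by simp [hh]⟩ : (Icc 0 h).Nonempty)
    (((hy.cont p).sub (hz.cont p)).norm.continuousOn (s := Icc 0 h))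
  set Δ := ‖y p m - z p m‖ with hΔ
  have hmax' : ∀ u ∈ Icc 0 h, ‖y p u - z p u‖ ≤ Δ := fun u hu => hmax hu
  have hcont : Continuous (fun v => η (y p v)) := hη.comp (hy.cont p)
  set B : ℝ → ℝ := fun u => K * Δ * u + 2 * C * ∫ v in (0:ℝ)..u, η (y p v) with hB
  have hBd : ∀ x, HasDerivAt B (K * Δ + 2 * C * η (y p x)) x := fun x => by
    have h1 := (intervalIntegral.integral_hasDerivAt_right
      (hcont.intervalIntegrable 0 x) (hcont.stronglyMeasurableAtFilter _ _) hcont.continuousAt)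
    have h2 := ((hasDerivAt_id x).const_mul (K * Δ)).add (h1.const_mul (2 * C))
    simp only [mul_one] at h2
    exact h2
  have key := image_norm_le_of_norm_deriv_right_le_deriv_boundary
    (f := fun u => y p u - z p u) (f' := fun u => W (y p u) - V (z p u)) (a := 0) (b := h)
    ((hy.cont p).sub (hz.cont p)).continuousOn
    (fun x hx => (hy.der p x hx.1).sub (hz.der p x hx.1))
    (B := B) (by simp [hB, hy.init, hz.init]) hBd
    (fun x hx => by
      have e : W (y p x) - V (z p x) = (V (y p x) - V (z p x)) + (W (y p x) - V (y p x)) := by abel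
      rw [e]
      refine (norm_add_le _ _).trans (add_le_add ?_ (hWV _))
      have := hV.norm_sub_le (y p x) (z p x)
      refine this.trans ?_
      gcongr
      exact hmax' x ⟨hx.1, hx.2.le⟩)
  have hmono : ∫ v in (0:ℝ)..m, η (y p v) ≤ ∫ v in (0:ℝ)..h, η (y p v) := by
    have := intervalIntegral.integral_add_adjacent_intervals
      (hcont.intervalIntegrable (μ := volume) 0 m) (hcont.intervalIntegrable m h)
    have h3 : 0 ≤ ∫ v in m..h, η (y p v) :=
      intervalIntegral.integral_nonneg hm.2 (fun _ _ => hη0 _)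
    linarith
  have h1 : Δ ≤ K * Δ * m + 2 * C * ∫ v in (0:ℝ)..m, η (y p v) := key hm
  have h0 : 0 ≤ Δ := norm_nonneg _
  have h2 : K * Δ * m ≤ 1 / 2 * Δ := by
    calc K * Δ * m ≤ K * Δ * h := by gcongr; exact hm.2
      _ = (K * h) * Δ := by ring
      _ ≤ _ := by gcongr
  have h3 : 2 * C * ∫ v in (0:ℝ)..m, η (y p v) ≤ 2 * C * ∫ v in (0:ℝ)..h, η (y p v) := by
    gcongr
  intro u hu
  have := hmax' u hu
  linarith

end flows

section Qsec
variable {E : Type*} [NormedAddCommGroup E] [NormedSpace ℝ E]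

noncomputable def QSM.Qf (γ : ℝ) (r : E → ℝ) (y : E → ℝ → E) (p : E) : ℝ :=
  ∫ t in Ioi (0:ℝ), γ ^ t * r (y p t)

theorem QSM.gamma_int {γ : ℝ} (hγ : γ ∈ Ioo (0:ℝ) 1) (a : ℝ) :
    IntegrableOn (fun t : ℝ => γ ^ t) (Ioi a) := by
  have h := integrableOn_exp_mul_Ioi (Real.log_neg hγ.1 hγ.2) a
  refine h.congr_fun (fun t _ => ?_) measurableSet_Ioi
  simp [Real.rpow_def_of_pos hγ.1]

theorem QSM.gamma_cont {γ : ℝ} (hγ : γ ∈ Ioo (0:ℝ) 1) : Continuous (fun t : ℝ => γ ^ t) :=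
  Real.continuous_const_rpow hγ.1.ne'

theorem QSM.Q_int {γ : ℝ} (hγ : γ ∈ Ioo (0:ℝ) 1) {f : ℝ → ℝ} (hf : Continuous f)
    (h01 : ∀ t, f t ∈ Icc (0:ℝ) 1) (a : ℝ) :
    IntegrableOn (fun t : ℝ => γ ^ t * f t) (Ioi a) := by
  refine (QSM.gamma_int hγ a).mono'
    (((QSM.gamma_cont hγ).mul hf).aestronglyMeasurable) (Filter.Eventually.of_forall fun t => ?_)
  have h1 : 0 < γ ^ t := Real.rpow_pos_of_pos hγ.1 t
  rw [Real.norm_eq_abs, abs_of_nonneg (mul_nonneg h1.le (h01 t).1)]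
  exact mul_le_of_le_one_right h1.le (h01 t).2

theorem QSM.Q_bound {γ : ℝ} (hγ : γ ∈ Ioo (0:ℝ) 1) {r : E → ℝ} (hr : Continuous r)
    (hr01 : ∀ q, r q ∈ Icc (0:ℝ) 1) {y : E → ℝ → E} (hy : ∀ p, Continuous (y p)) (p : E) :
    QSM.Qf γ r y p ∈ Icc 0 (∫ t in Ioi (0:ℝ), γ ^ t) := by
  constructor
  · exact setIntegral_nonneg measurableSet_Ioi
      (fun t _ => mul_nonneg (Real.rpow_pos_of_pos hγ.1 t).le (hr01 _).1)
  · exact setIntegral_mono (QSM.Q_int hγ (hr.comp (hy p)) (fun t => hr01 _) 0)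
      (QSM.gamma_int hγ 0)
      (fun t => mul_le_of_le_one_right (Real.rpow_pos_of_pos hγ.1 t).le (hr01 _).2)

theorem QSM.Q_split {γ : ℝ} (hγ : γ ∈ Ioo (0:ℝ) 1) {r : E → ℝ} (hr : Continuous r)
    (hr01 : ∀ q, r q ∈ Icc (0:ℝ) 1) {V : E → E} {K : NNReal} (hV : LipschitzWith K V)
    {y : E → ℝ → E} (hy : QSM.IsFlow V y) (p : E) {T : ℝ} (hT : 0 ≤ T) :
    QSM.Qf γ r y p = (∫ t in (0:ℝ)..T, γ ^ t * r (y p t)) + γ ^ T * QSM.Qf γ r y (y p T) := by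
  have hi := QSM.Q_int hγ (hr.comp (hy.cont p)) (fun t => hr01 _)
  have h1 := intervalIntegral.integral_interval_add_Ioi (hi 0) (hi T)
  have h2 : ∫ t in Ioi T, γ ^ t * r (y p t) = γ ^ T * QSM.Qf γ r y (y p T) := by
    have h3 := (measurePreserving_add_left volume T).setIntegral_preimage_emb
      (measurableEmbedding_addLeft T) (fun t => γ ^ t * r (y p t)) (Ioi T)
    rw [← h3, QSM.Qf, ← integral_const_mul]
    simp only [preimage_const_add_Ioi, sub_self]
    refine setIntegral_congr_fun measurableSet_Ioi (fun t ht => ?_)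
    rw [hy.semigroup hV p hT (le_of_lt ht), Real.rpow_add hγ.1]
    ring
  rw [← h2, QSM.Qf]
  exact h1.symm

/-- no gain away from the perturbation -/
theorem QSM.gain_zero {γ : ℝ} (hγ : γ ∈ Ioo (0:ℝ) 1) {r : E → ℝ} (hr : Continuous r)
    (hr01 : ∀ q, r q ∈ Icc (0:ℝ) 1) {V W : E → E} {K K' : NNReal} (hV : LipschitzWith K V)
    (hW : LipschitzWith K' W)
    {y z : E → ℝ → E} (hy : QSM.IsFlow W y) (hz : QSM.IsFlow V z) (p : E) {T : ℝ} (hT : 0 ≤ T)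
    (h : ∀ u ∈ Ico 0 T, W (y p u) = V (y p u)) :
    QSM.Qf γ r y p - QSM.Qf γ r z p =
      γ ^ T * (QSM.Qf γ r y (y p T) - QSM.Qf γ r z (y p T)) := by
  have he := QSM.IsFlow.eq_of_agree hV hy hz p h
  rw [QSM.Q_split hγ hr hr01 hV hz p hT, QSM.Q_split hγ hr hr01 hW hy p hT,
    ← he T ⟨hT, le_rfl⟩]
  have : ∫ t in (0:ℝ)..T, γ ^ t * r (y p t) = ∫ t in (0:ℝ)..T, γ ^ t * r (z p t) := by
    refine intervalIntegral.integral_congr (fun t ht => ?_)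
    rw [uIcc_of_le hT] at ht
    simp only [he t ht]
  rw [this]; ring

/-- gain in a window -/
theorem QSM.gain_window {γ : ℝ} (hγ : γ ∈ Ioo (0:ℝ) 1) {r : E → ℝ} (hr : Continuous r)
    (hr01 : ∀ q, r q ∈ Icc (0:ℝ) 1) {V W : E → E} {K K' : NNReal} (hV : LipschitzWith K V)
    (hW : LipschitzWith K' W)
    {y z : E → ℝ → E} (hy : QSM.IsFlow W y) (hz : QSM.IsFlow V z) {C δ T κ R Lr : ℝ}
    (pst : E) (D : E →L[ℝ] ℝ)
    (hC : 0 ≤ C) (hKh : K * T ≤ 1 / 2) {η : E → ℝ} (hη : Continuous η)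
    (hη0 : ∀ q, 0 ≤ η q) (hWV : ∀ q, ‖W q - V q‖ ≤ 2 * C * η q)
    (hDW : ∀ q, δ / 2 * η q ≤ D (W q - V q)) (hδ : 0 < δ) (hLr0 : 0 ≤ Lr)
    (hγT : 1 / 2 ≤ γ ^ T) (hT1 : 4 * C * ‖D‖ * K * T ≤ δ / 4) (hT2 : 4 * C * Lr * T ≤ δ / 16)
    (hκ : 0 ≤ κ)
    (hrL : ∀ q ∈ Metric.closedBall pst R, ∀ q' ∈ Metric.closedBall pst R,
      |r q - r q'| ≤ Lr * ‖q - q'‖)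
    (hQd : ∀ q ∈ Metric.closedBall pst R,
      |QSM.Qf γ r z q - QSM.Qf γ r z pst - D (q - pst)| ≤ κ * R)
    (p : E) {h : ℝ} (hh : 0 ≤ h) (hhT : h ≤ T)
    (hyR : ∀ u ∈ Icc 0 h, y p u ∈ Metric.closedBall pst R)
    (hzR : ∀ u ∈ Icc 0 h, z p u ∈ Metric.closedBall pst R) :
    δ / 16 * (∫ v in (0:ℝ)..h, η (y p v)) - 2 * κ * R
      + γ ^ h * (QSM.Qf γ r y (y p h) - QSM.Qf γ r z (y p h)) ≤
    QSM.Qf γ r y p - QSM.Qf γ r z p := by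
  have hcont : Continuous (fun v => η (y p v)) := hη.comp (hy.cont p)
  have hKh' : K * h ≤ 1 / 2 := le_trans (by gcongr) hKh
  have hcmp := QSM.IsFlow.compare hV hy hz p hC hh hKh' hη hη0 hWV
  set I := ∫ v in (0:ℝ)..h, η (y p v) with hI
  have hI0 : 0 ≤ I := intervalIntegral.integral_nonneg hh (fun _ _ => hη0 _)
  have hR : 0 ≤ R := Metric.nonempty_closedBall.1 ⟨_, hyR 0 ⟨le_rfl, hh⟩⟩
  -- linear part
  have hlin : δ / 2 * I - ‖D‖ * (K * (4 * C * I)) * h ≤ D (y p h - z p h) := by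
    have key := image_le_of_deriv_right_le_deriv_boundary
      (f := fun u => δ / 2 * (∫ v in (0:ℝ)..u, η (y p v)) - ‖D‖ * (K * (4 * C * I)) * u)
      (f' := fun u => δ / 2 * η (y p u) - ‖D‖ * (K * (4 * C * I)) * 1)
      (B := fun u => D (y p u - z p u)) (B' := fun u => D (W (y p u) - V (z p u)))
      (a := 0) (b := h)
      (by
        have : Continuous (fun u => ∫ v in (0:ℝ)..u, η (y p v)) :=
          intervalIntegral.continuous_primitive (fun a b => hcont.intervalIntegrable a b) 0
        fun_prop)
      (fun x _ => by
        have h1 := (intervalIntegral.integral_hasDerivAt_right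
          (hcont.intervalIntegrable 0 x) (hcont.stronglyMeasurableAtFilter _ _)
          hcont.continuousAt)
        exact ((h1.const_mul (δ / 2)).sub ((hasDerivAt_id x).const_mul _)).hasDerivWithinAt)
      (by simp [hy.init, hz.init])
      (D.continuous.comp ((hy.cont p).sub (hz.cont p))).continuousOn
      (fun x hx => by
        have := (hy.der p x hx.1).sub (hz.der p x hx.1)
        exact D.hasFDerivAt.comp_hasDerivWithinAt x this)
      (fun x hx => by
        have e : W (y p x) - V (z p x) = (V (y p x) - V (z p x)) + (W (y p x) - V (y p x)) := by
          abel
        rw [e, map_add]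
        have h1 := hDW (y p x)
        have h2 : |D (V (y p x) - V (z p x))| ≤ ‖D‖ * (K * (4 * C * I)) := by
          refine (D.le_opNorm _).trans ?_
          gcongr
          refine (hV.norm_sub_le _ _).trans ?_
          gcongr
          exact hcmp x ⟨hx.1, hx.2.le⟩
        have h3 := neg_abs_le (D (V (y p x) - V (z p x)))
        linarith)
    exact key (x := h) ⟨hh, le_rfl⟩
  have hh' : h ∈ Icc 0 h := ⟨hh, le_rfl⟩
  have hQ1 := abs_le.1 (hQd _ (hyR h hh'))
  have hQ2 := abs_le.1 (hQd _ (hzR h hh'))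
  have e1 : D (y p h - z p h) = D (y p h - pst) - D (z p h - pst) := by
    rw [← map_sub]; congr 1; abel
  have hQ : δ / 4 * I - 2 * κ * R ≤ QSM.Qf γ r z (y p h) - QSM.Qf γ r z (z p h) := by
    have : ‖D‖ * (K * (4 * C * I)) * h ≤ δ / 4 * I := by
      calc ‖D‖ * (K * (4 * C * I)) * h ≤ ‖D‖ * (K * (4 * C * I)) * T := by gcongr
        _ = (4 * C * ‖D‖ * K * T) * I := by ring
        _ ≤ _ := by gcongr
    linarith [hQ1.1, hQ2.2]
  have hγh : 1 / 2 ≤ γ ^ h :=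
    hγT.trans (Real.rpow_le_rpow_of_exponent_ge hγ.1 hγ.2.le hhT)
  have hγh1 : γ ^ h ≤ 1 := Real.rpow_le_one hγ.1.le hγ.2.le hh
  have hr' : -(δ / 16 * I) ≤
      (∫ t in (0:ℝ)..h, γ ^ t * r (y p t)) - ∫ t in (0:ℝ)..h, γ ^ t * r (z p t) := by
    have c1 : Continuous (fun t : ℝ => γ ^ t * r (y p t)) :=
      (QSM.gamma_cont hγ).mul (hr.comp (hy.cont p))
    have c2 : Continuous (fun t : ℝ => γ ^ t * r (z p t)) :=
      (QSM.gamma_cont hγ).mul (hr.comp (hz.cont p))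
    rw [← intervalIntegral.integral_sub (c1.intervalIntegrable _ _) (c2.intervalIntegrable _ _)]
    have := intervalIntegral.norm_integral_le_of_norm_le_const (a := 0) (b := h)
      (f := fun t => γ ^ t * r (y p t) - γ ^ t * r (z p t)) (C := Lr * (4 * C * I))
      (fun t ht => by
        rw [uIoc_of_le hh] at ht
        have ht' : t ∈ Icc 0 h := ⟨ht.1.le, ht.2⟩
        rw [← mul_sub, norm_mul, Real.norm_eq_abs, Real.norm_eq_abs,
          abs_of_pos (Real.rpow_pos_of_pos hγ.1 t)]
        have g1 : γ ^ t ≤ 1 := Real.rpow_le_one hγ.1.le hγ.2.le ht.1.le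
        have g2 := hrL _ (hyR t ht') _ (hzR t ht')
        have g3 : Lr * ‖y p t - z p t‖ ≤ Lr * (4 * C * I) := by
          gcongr; exact hcmp t ht'
        calc γ ^ t * |r (y p t) - r (z p t)| ≤ 1 * |r (y p t) - r (z p t)| := by gcongr
          _ ≤ _ := by linarith)
    rw [Real.norm_eq_abs, sub_zero, abs_of_nonneg hh] at this
    have h4 : Lr * (4 * C * I) * h ≤ δ / 16 * I := by
      calc Lr * (4 * C * I) * h ≤ Lr * (4 * C * I) * T := by gcongr
        _ = (4 * C * Lr * T) * I := by ring
        _ ≤ _ := by gcongr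
    linarith [(abs_le.1 (this.trans h4)).1]
  rw [QSM.Q_split hγ hr hr01 hV hz p hh, QSM.Q_split hγ hr hr01 hW hy p hh]
  have f1 : γ ^ h * (δ / 4 * I - 2 * κ * R) ≤
      γ ^ h * (QSM.Qf γ r z (y p h) - QSM.Qf γ r z (z p h)) := by gcongr
  have f2 : 1 / 2 * (δ / 4 * I) ≤ γ ^ h * (δ / 4 * I) := by gcongr
  have f3 : γ ^ h * (2 * κ * R) ≤ 1 * (2 * κ * R) := by gcongr
  linarith

/-- contraction argument -/
theorem QSM.inf_bound {P : Type*} {G : P → ℝ} {Y : P → P} {e q B : ℝ} (hq0 : 0 ≤ q) (hq : q < 1)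
    (hB : ∀ p, -B ≤ G p) (h : ∀ p, -e + q * G (Y p) ≤ G p) (p : P) : -e / (1 - q) ≤ G p := by
  have : Nonempty P := ⟨p⟩
  have hbd : BddBelow (range G) := ⟨-B, by rintro _ ⟨p, rfl⟩; exact hB p⟩
  have h1 : -e + q * (⨅ p, G p) ≤ ⨅ p, G p := le_ciInf fun p' =>
    le_trans (by gcongr; exact ciInf_le hbd _) (h p')
  refine le_trans ?_ (ciInf_le hbd p)
  rw [div_le_iff₀ (by linarith)]
  linarith

end Qsec

section escape
variable {E : Type*} [NormedAddCommGroup E] [NormedSpace ℝ E]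

structure QSM.Pert (V W : E → E) (η : E → ℝ) (y : E → ℝ → E) (pst : E) (C ε ρ : ℝ) : Prop where
  cont : Continuous η
  nonneg : ∀ q, 0 ≤ η q
  le : ∀ q, η q ≤ ε
  one : ∀ q ∈ Metric.closedBall pst (ρ / 2), η q = ε
  zero : ∀ q, q ∉ Metric.ball pst ρ → η q = 0
  diff : ∀ q, ‖W q - V q‖ ≤ 2 * C * η q
  flow : QSM.IsFlow W y

def QSM.Conc (η : E → ℝ) (y z : E → ℝ → E) (p₀ pst : E) (T R M c ρ : ℝ) : Prop :=
  (∀ p, (∀ u ∈ Ico 0 T, y p u ∉ Metric.ball pst ρ) ∨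
    ∃ α β, 0 ≤ α ∧ α ≤ β ∧ β ≤ T ∧ (∀ u ∈ Ico 0 α, y p u ∉ Metric.ball pst ρ) ∧
      (∀ u ∈ Ico β T, y p u ∉ Metric.ball pst ρ) ∧
      (∀ u ∈ Icc α β, y p u ∈ Metric.closedBall pst (R * ρ)) ∧
      ∫ v in α..β, η (y p v) ≤ M * ρ) ∧
  ∃ τ, 0 ≤ τ ∧ (∀ u ∈ Ico 0 τ, z p₀ u ∉ Metric.ball pst ρ) ∧
    c * ρ ≤ ∫ v in (0:ℝ)..T, η (y (z p₀ τ) v)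

theorem QSM.int_const_le {f : ℝ → ℝ} (hf : Continuous f) (hf0 : ∀ t, 0 ≤ f t) {T a b k : ℝ}
    (ha : 0 ≤ a) (hab : a ≤ b) (hb : b ≤ T) (h : ∀ t ∈ Icc a b, k ≤ f t) :
    (b - a) * k ≤ ∫ v in (0:ℝ)..T, f v := by
  have i := fun x y => hf.intervalIntegrable (μ := volume) x y
  have h1 := intervalIntegral.integral_add_adjacent_intervals (i 0 a) (i a b)
  have h2 := intervalIntegral.integral_add_adjacent_intervals (i 0 b) (i b T)
  have h3 : 0 ≤ ∫ v in (0:ℝ)..a, f v := intervalIntegral.integral_nonneg ha fun _ _ => hf0 _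
  have h4 : 0 ≤ ∫ v in b..T, f v := intervalIntegral.integral_nonneg hb fun _ _ => hf0 _
  have h5 : ∫ v in a..b, k ≤ ∫ v in a..b, f v :=
    intervalIntegral.integral_mono_on hab (by simp) (i a b) h
  simp only [intervalIntegral.integral_const, smul_eq_mul] at h5
  linarith

theorem QSM.int_le_const {f : ℝ → ℝ} (hf : Continuous f) {a b k : ℝ}
    (hab : a ≤ b) (h : ∀ t, f t ≤ k) :
    ∫ v in a..b, f v ≤ (b - a) * k := by
  have h5 : ∫ v in a..b, f v ≤ ∫ v in a..b, k :=
    intervalIntegral.integral_mono_on hab (hf.intervalIntegrable _ _) (by simp) (fun t _ => h t)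
  simpa using h5

theorem QSM.escape_eq {V : E → E} {K : NNReal} (hV : LipschitzWith K V) {z : E → ℝ → E}
    (hz : QSM.IsFlow V z) {p₀ pst : E} {C t₁ : ℝ} (hC : 0 < C) (ht₁ : 0 ≤ t₁)
    (hhit : z p₀ t₁ = pst) (hfirst : ∀ t ∈ Ico 0 t₁, z p₀ t ≠ pst) (hv : V pst = 0)
    {Tb : ℝ} (hTb : 0 < Tb) (hTbK : K * Tb ≤ 1 / 2) :
    ∃ T R M c ρb : ℝ, 0 < T ∧ T ≤ Tb ∧ 0 < R ∧ 0 ≤ M ∧ 0 < c ∧ 0 < ρb ∧ ∀ ρ, 0 < ρ → ρ < ρb →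
      ∃ ε, 0 < ε ∧ ε ≤ 1 ∧ ∀ W η y, QSM.Pert V W η y pst C ε ρ →
        QSM.Conc η y z p₀ pst T R M c ρ := by
  have hVb : ∀ q, ‖V q‖ ≤ K * ‖q - pst‖ := fun q => by
    have := hV.norm_sub_le q pst; rwa [hv, sub_zero] at this
  -- first hit at time zero
  have ht0 : t₁ = 0 := by
    by_contra hne
    have hpos : 0 < t₁ := lt_of_le_of_ne ht₁ (Ne.symm hne)
    set θ := min t₁ Tb with hθ
    have hθ0 : 0 < θ := lt_min hpos hTb
    have hle : θ ≤ t₁ := min_le_left _ _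
    have e1 : z (z p₀ (t₁ - θ)) θ = pst := by
      rw [hz.semigroup hV p₀ (by linarith) hθ0.le]; simpa using hhit
    have := hz.apriori (z p₀ (t₁ - θ)) pst (L := K) (k := 0) (h := θ) (u₀ := θ) K.2 le_rfl
      (le_trans (by gcongr; exact min_le_right _ _) hTbK) ⟨hθ0.le, le_rfl⟩
      (fun w _ => by simpa using hVb _) 0 ⟨le_rfl, hθ0.le⟩
    rw [e1, hz.init] at this
    simp only [sub_self, norm_zero, mul_zero, add_zero] at this
    exact hfirst (t₁ - θ) ⟨by linarith, by linarith⟩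
      (sub_eq_zero.1 (norm_le_zero_iff.1 this))
  subst ht0
  rw [hz.init] at hhit
  subst hhit
  set T := min Tb (1 / (8 * C)) with hTdef
  have hT0 : 0 < T := lt_min hTb (by positivity)
  have hTK : K * T ≤ 1 / 2 := le_trans (by gcongr; exact min_le_left _ _) hTbK
  have hTC : C * T ≤ 1 / 8 := by
    have : T ≤ 1 / (8 * C) := min_le_right _ _
    rw [le_div_iff₀ (by positivity)] at this
    linarith
  refine ⟨T, 3, T, T, 1, hT0, min_le_left _ _, by norm_num, hT0.le, hT0, one_pos,
    fun ρ hρ hρ1 => ⟨ρ, hρ, hρ1.le, fun W η y hP => ?_⟩⟩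
  have hW : ∀ q, ‖W q‖ ≤ K * ‖q - p₀‖ + 2 * C * ρ := fun q => by
    have e : W q = V q + (W q - V q) := by abel
    rw [e]
    refine (norm_add_le _ _).trans (add_le_add (hVb q) ((hP.diff q).trans ?_))
    gcongr; exact hP.le q
  have hap := fun p u₀ (hu₀ : u₀ ∈ Icc 0 T) => hP.flow.apriori p p₀ (L := K) (k := 2 * C * ρ)
    (h := T) (u₀ := u₀) K.2 (by positivity) hTK hu₀ (fun w _ => hW _)
  have hsm : 2 * T * (2 * C * ρ) ≤ ρ / 2 := by nlinarith
  have hcont : ∀ p, Continuous fun v => η (y p v) := fun p => hP.cont.comp (hP.flow.cont p)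
  constructor
  · intro p
    by_cases hex : ∀ u ∈ Ico 0 T, y p u ∉ Metric.ball p₀ ρ
    · exact Or.inl hex
    · push Not at hex
      obtain ⟨u₀, hu₀, hb⟩ := hex
      refine Or.inr ⟨0, T, le_rfl, hT0.le, le_rfl, by simp, by simp, fun u hu => ?_, ?_⟩
      · rw [Metric.mem_ball, dist_eq_norm] at hb
        rw [Metric.mem_closedBall, dist_eq_norm]
        have := hap p u₀ ⟨hu₀.1, hu₀.2.le⟩ u hu
        linarith
      · have := QSM.int_le_const (hcont p) hT0.le (fun t => hP.le (y p t))
        simpa using this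
  · refine ⟨0, le_rfl, by simp, ?_⟩
    rw [hz.init]
    have := QSM.int_const_le (hcont p₀) (fun t => hP.nonneg _) (T := T) (a := 0) (b := T) (k := ρ)
      le_rfl hT0.le le_rfl (fun t ht => by
        refine (hP.one _ ?_).ge
        rw [Metric.mem_closedBall, dist_eq_norm]
        have := hap p₀ 0 ⟨le_rfl, hT0.le⟩ t ht
        rw [hP.flow.init] at this
        simp only [sub_self, norm_zero] at this
        linarith)
    simpa using this

theorem QSM.escape_neq {V : E → E} {K : NNReal} (hV : LipschitzWith K V) {z : E → ℝ → E}
    (hz : QSM.IsFlow V z) {p₀ pst : E} {C t₁ : ℝ} (hC : 0 < C) (ht₁ : 0 ≤ t₁)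
    (hhit : z p₀ t₁ = pst) (hfirst : ∀ t ∈ Ico 0 t₁, z p₀ t ≠ pst) (hv : V pst ≠ 0)
    {Tb : ℝ} (hTb : 0 < Tb) (hTbK : K * Tb ≤ 1 / 2) :
    ∃ T R M c ρb : ℝ, 0 < T ∧ T ≤ Tb ∧ 0 < R ∧ 0 ≤ M ∧ 0 < c ∧ 0 < ρb ∧ ∀ ρ, 0 < ρ → ρ < ρb →
      ∃ ε, 0 < ε ∧ ε ≤ 1 ∧ ∀ W η y, QSM.Pert V W η y pst C ε ρ →
        QSM.Conc η y z p₀ pst T R M c ρ := by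
  set v := ‖V pst‖ with hvdef
  have hv0 : 0 < v := norm_pos_iff.2 hv
  set ε := min 1 (v / (8 * C)) with hε
  have hε0 : 0 < ε := lt_min one_pos (by positivity)
  have hεC : 2 * C * ε ≤ v / 4 := by
    have : ε ≤ v / (8 * C) := min_le_right _ _
    rw [le_div_iff₀ (by positivity)] at this
    linarith
  set ρ₂ := v / (4 * (K + 1)) with hρ₂
  have hK1 : (0:ℝ) < K + 1 := by positivity
  have hρ₂0 : 0 < ρ₂ := by positivity
  have hKρ₂ : K * ρ₂ ≤ v / 4 := by
    have h1 : (K + 1) * ρ₂ = v / 4 := by rw [hρ₂]; field_simp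
    linarith
  set T := min Tb (ρ₂ / (5 * v)) with hTdef
  have hT0 : 0 < T := lt_min hTb (by positivity)
  have hTK : K * T ≤ 1 / 2 := le_trans (by gcongr; exact min_le_left _ _) hTbK
  have hTv : 5 * v * T ≤ ρ₂ := by
    have : T ≤ ρ₂ / (5 * v) := min_le_right _ _
    rw [le_div_iff₀ (by positivity)] at this
    linarith
  set τ := max (t₁ - T / 2) 0 with hτ
  have hτ0 : 0 ≤ τ := le_max_right _ _
  have hτ1 : τ ≤ t₁ := max_le (by linarith) ht₁
  have hτ2 : t₁ - τ ≤ T / 2 := by linarith [le_max_left (t₁ - T / 2) 0]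
  -- distance of early trajectory to pst
  obtain ⟨ρ₃, hρ₃0, hρ₃⟩ : ∃ ρ₃ > 0, ∀ u ∈ Ico 0 τ, ρ₃ ≤ ‖z p₀ u - pst‖ := by
    rcases eq_or_lt_of_le hτ0 with h0 | h0
    · exact ⟨1, one_pos, by rw [← h0]; simp⟩
    · have hlt : τ < t₁ := by
        rcases max_choice (t₁ - T / 2) 0 with h | h
        · rw [hτ, h]; linarith
        · rw [← hτ] at h; linarith
      obtain ⟨m, hm, hmin⟩ := isCompact_Icc.exists_isMinOn
        (⟨0, by simp [hτ0]⟩ : (Icc 0 τ).Nonempty)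
        (((hz.cont p₀).sub (continuous_const (y := pst))).norm.continuousOn (s := Icc 0 τ))
      refine ⟨‖z p₀ m - pst‖, ?_, fun u hu => hmin ⟨hu.1, hu.2.le⟩⟩
      exact norm_pos_iff.2 (sub_ne_zero.2 (hfirst m ⟨hm.1, lt_of_le_of_lt hm.2 hlt⟩))
  set M' := 4 / v with hM'
  have hM'v : M' * v = 4 := by rw [hM']; field_simp
  have hM'0 : 0 < M' := by positivity
  set c := min (1 / (16 * C)) (ε / (8 * v)) with hc
  have hc0 : 0 < c := lt_min (by positivity) (by positivity)
  set ρb := min (min ρ₃ (ρ₂ / 4)) (4 * v * T) with hρb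
  refine ⟨T, 7, 2 * M', c, ρb, hT0, min_le_left _ _, by norm_num, by positivity, hc0,
    lt_min (lt_min hρ₃0 (by positivity)) (by positivity),
    fun ρ hρ hρ1 => ⟨ε, hε0, min_le_left _ _, fun W η y hP => ?_⟩⟩
  have hρa : ρ < ρ₃ := hρ1.trans_le ((min_le_left _ _).trans (min_le_left _ _))
  have hρc : ρ < ρ₂ / 4 := hρ1.trans_le ((min_le_left _ _).trans (min_le_right _ _))
  have hρd : ρ < 4 * v * T := hρ1.trans_le (min_le_right _ _)
  have hWv : ∀ q, ‖W q - V pst‖ ≤ K * ‖q - pst‖ + v / 4 := fun q => by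
    have e : W q - V pst = (V q - V pst) + (W q - V q) := by abel
    rw [e]
    refine (norm_add_le _ _).trans (add_le_add (hV.norm_sub_le _ _) ((hP.diff q).trans ?_))
    refine le_trans ?_ hεC
    gcongr; exact hP.le q
  have hW : ∀ q, ‖W q‖ ≤ K * ‖q - pst‖ + 5 * v / 4 := fun q => by
    have e : W q = (W q - V pst) + V pst := by abel
    rw [e]
    refine (norm_add_le _ _).trans ?_
    have := hWv q
    linarith
  have hap : ∀ p u₀, u₀ ∈ Icc 0 T → ‖y p u₀ - pst‖ < ρ → ∀ u ∈ Icc 0 T, ‖y p u - pst‖ ≤ ρ₂ := by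
    intro p u₀ hu₀ hn u hu
    have := hP.flow.apriori p pst (L := K) (k := 5 * v / 4)
      (h := T) (u₀ := u₀) K.2 (by positivity) hTK hu₀ (fun w _ => hW _) u hu
    nlinarith
  -- velocity estimate
  have hvel : ∀ p u₀, u₀ ∈ Icc 0 T → ‖y p u₀ - pst‖ < ρ → ∀ a b, 0 ≤ a → a ≤ b → b ≤ T →
      ‖y p b - y p a - (b - a) • V pst‖ ≤ v / 2 * (b - a) := by
    intro p u₀ hu₀ hn a b ha hab hb
    refine hP.flow.mv p (V pst) ha hab (fun w hw => (hWv _).trans ?_)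
    have := hap p u₀ hu₀ hn w ⟨ha.trans hw.1, hw.2.trans hb⟩
    have h2 : K * ‖y p w - pst‖ ≤ K * ρ₂ := by gcongr
    linarith
  have hup : ∀ p u₀, u₀ ∈ Icc 0 T → ‖y p u₀ - pst‖ < ρ → ∀ a b, 0 ≤ a → a ≤ b → b ≤ T →
      ‖y p b - y p a‖ ≤ 3 * v / 2 * (b - a) := by
    intro p u₀ hu₀ hn a b ha hab hb
    have h1 := hvel p u₀ hu₀ hn a b ha hab hb
    have h2 : ‖(b - a) • V pst‖ = (b - a) * v := by
      rw [norm_smul, Real.norm_eq_abs, abs_of_nonneg (by linarith)]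
    have h3 := norm_sub_norm_le (y p b - y p a) ((b - a) • V pst)
    linarith
  have hlow : ∀ p u₀, u₀ ∈ Icc 0 T → ‖y p u₀ - pst‖ < ρ → ∀ a b, 0 ≤ a → a ≤ b → b ≤ T →
      v / 2 * (b - a) ≤ ‖y p b - y p a‖ := by
    intro p u₀ hu₀ hn a b ha hab hb
    have h1 := hvel p u₀ hu₀ hn a b ha hab hb
    have h2 : ‖(b - a) • V pst‖ = (b - a) * v := by
      rw [norm_smul, Real.norm_eq_abs, abs_of_nonneg (by linarith)]
    have h3 := norm_sub_norm_le ((b - a) • V pst) (y p b - y p a)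
    rw [norm_sub_rev ((b - a) • V pst)] at h3
    linarith
  have hcont : ∀ p, Continuous fun v => η (y p v) := fun p => hP.cont.comp (hP.flow.cont p)
  constructor
  · intro p
    by_cases hex : ∀ u ∈ Ico 0 T, y p u ∉ Metric.ball pst ρ
    · exact Or.inl hex
    · push Not at hex
      obtain ⟨u₀, hu₀, hb⟩ := hex
      rw [Metric.mem_ball, dist_eq_norm] at hb
      have hu₀' : u₀ ∈ Icc 0 T := ⟨hu₀.1, hu₀.2.le⟩
      have hMρ : 0 < M' * ρ := by positivity
      have hfar : ∀ s, M' * ρ ≤ s → 2 * ρ ≤ v / 2 * s := fun s hs => by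
        have : v / 2 * (M' * ρ) ≤ v / 2 * s := by gcongr
        have e : v / 2 * (M' * ρ) = (M' * v) * ρ / 2 := by ring
        rw [e, hM'v] at this; linarith
      have hnear : ∀ s, s ≤ M' * ρ → 3 * v / 2 * s ≤ 6 * ρ := fun s hs => by
        have : 3 * v / 2 * s ≤ 3 * v / 2 * (M' * ρ) := by gcongr
        have e : 3 * v / 2 * (M' * ρ) = (M' * v) * ρ * 3 / 2 := by ring
        rw [e, hM'v] at this; linarith
      have htri : ∀ u, ‖y p u - y p u₀‖ ≤ ‖y p u - pst‖ + ‖y p u₀ - pst‖ := fun u => by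
        have e : y p u - y p u₀ = (y p u - pst) - (y p u₀ - pst) := by abel
        rw [e]; exact norm_sub_le _ _
      have htri2 : ∀ u, ‖y p u - pst‖ ≤ ‖y p u - y p u₀‖ + ‖y p u₀ - pst‖ := fun u => by
        have e : y p u - pst = (y p u - y p u₀) + (y p u₀ - pst) := by abel
        rw [e]; exact norm_add_le _ _
      refine Or.inr ⟨max 0 (u₀ - M' * ρ), min T (u₀ + M' * ρ), le_max_left _ _,
        (max_le hu₀.1 (by linarith)).trans (le_min hu₀.2.le (by linarith)), min_le_left _ _,
        fun u hu hm => ?_, fun u hu hm => ?_, fun u hu => ?_, ?_⟩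
      · rw [Metric.mem_ball, dist_eq_norm] at hm
        have hu2 : u < u₀ - M' * ρ := by
          rcases lt_max_iff.1 hu.2 with h | h
          · linarith [hu.1]
          · exact h
        have h1 := hlow p u₀ hu₀' hb u u₀ hu.1 (by linarith) hu₀'.2
        have h2 := hfar (u₀ - u) (by linarith)
        have h3 := htri u
        rw [norm_sub_rev] at h3
        linarith
      · rw [Metric.mem_ball, dist_eq_norm] at hm
        have hu2 : u₀ + M' * ρ ≤ u := by
          rcases min_le_iff.1 hu.1 with h | h
          · linarith [hu.2]
          · exact h
        have h1 := hlow p u₀ hu₀' hb u₀ u hu₀.1 (by linarith) hu.2.le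
        have h2 := hfar (u - u₀) (by linarith)
        have h3 := htri u
        linarith
      · rw [Metric.mem_closedBall, dist_eq_norm]
        have a1 := (max_le_iff.1 hu.1)
        have a2 := (le_min_iff.1 hu.2)
        have h3 := htri2 u
        rcases le_total u u₀ with h | h
        · have h1 := hup p u₀ hu₀' hb u u₀ a1.1 h hu₀'.2
          have h2 := hnear (u₀ - u) (by linarith)
          rw [norm_sub_rev] at h1
          linarith
        · have h1 := hup p u₀ hu₀' hb u₀ u hu₀.1 h a2.1
          have h2 := hnear (u - u₀) (by linarith)
          linarith
      · have h1 := QSM.int_le_const (hcont p)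
          ((max_le hu₀.1 (by linarith : u₀ - M' * ρ ≤ u₀)).trans
            (le_min hu₀.2.le (by linarith : u₀ ≤ u₀ + M' * ρ)))
          (fun t => (hP.le (y p t)).trans (min_le_left _ _))
        have h2 := le_max_right 0 (u₀ - M' * ρ)
        have h3 := min_le_right T (u₀ + M' * ρ)
        linarith
  · refine ⟨τ, hτ0, fun u hu hm => ?_, ?_⟩
    · rw [Metric.mem_ball, dist_eq_norm] at hm
      linarith [hρ₃ u hu]
    · set p := z p₀ τ with hp
      set θ := t₁ - τ with hθ
      have hθ0 : 0 ≤ θ := by linarith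
      have hzθ : z p θ = pst := by
        rw [hp, hz.semigroup hV p₀ hτ0 hθ0, ← hhit]; congr 1; linarith
      have hcmp := QSM.IsFlow.compare hV hP.flow hz p hC.le hθ0
        (le_trans (by gcongr; linarith) hTK) hP.cont hP.nonneg hP.diff θ ⟨hθ0, le_rfl⟩
      rw [hzθ] at hcmp
      have hI1 : ∫ v in (0:ℝ)..θ, η (y p v) ≤ ∫ v in (0:ℝ)..T, η (y p v) := by
        have := intervalIntegral.integral_add_adjacent_intervals
          ((hcont p).intervalIntegrable (μ := volume) 0 θ) ((hcont p).intervalIntegrable θ T)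
        have h3 : 0 ≤ ∫ v in θ..T, η (y p v) :=
          intervalIntegral.integral_nonneg (by linarith) (fun _ _ => hP.nonneg _)
        linarith
      by_cases hcase : ‖y p θ - pst‖ < ρ / 4
      · have hn : ‖y p θ - pst‖ < ρ := by linarith
        have hθT : θ ∈ Icc 0 T := ⟨hθ0, by linarith⟩
        have hlen : ρ / (8 * v) ≤ T / 2 := by
          rw [div_le_iff₀ (by positivity)]; linarith
        have hlv : ρ / (8 * v) * v = ρ / 8 := by field_simp
        have := QSM.int_const_le (hcont p) (fun t => hP.nonneg _) (T := T) (a := θ)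
          (b := θ + ρ / (8 * v)) (k := ε) hθ0 (by linarith [show 0 < ρ / (8 * v) by positivity])
          (by linarith) (fun t ht => by
            refine (hP.one _ ?_).ge
            rw [Metric.mem_closedBall, dist_eq_norm]
            have h1 := hup p θ hθT hn θ t hθ0 ht.1 (by linarith [ht.2])
            have h2 : 3 * v / 2 * (t - θ) ≤ 3 * v / 2 * (ρ / (8 * v)) := by
              gcongr; linarith [ht.2]
            have e : y p t - pst = (y p t - y p θ) + (y p θ - pst) := by abel
            rw [e]
            have := norm_add_le (y p t - y p θ) (y p θ - pst)
            linarith)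
        refine le_trans ?_ this
        calc c * ρ ≤ ε / (8 * v) * ρ := by gcongr; exact min_le_right _ _
          _ = _ := by ring
      · push Not at hcase
        have h1 : c * ρ ≤ 1 / (16 * C) * ρ := by gcongr; exact min_le_left _ _
        have h2 : 1 / (16 * C) * ρ ≤ ∫ v in (0:ℝ)..θ, η (y p v) := by
          rw [one_div_mul_eq_div, div_le_iff₀ (by positivity)]
          linarith
        linarith

end escape

section abstractMain
variable {E : Type*} [NormedAddCommGroup E] [NormedSpace ℝ E]

theorem QSM.int_zero {f : ℝ → ℝ} {a b : ℝ} (hab : a ≤ b) (h : ∀ t ∈ Ico a b, f t = 0) :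
    ∫ v in a..b, f v = 0 := by
  rw [intervalIntegral.integral_of_le hab, ← integral_Ico_eq_integral_Ioc,
    setIntegral_congr_fun measurableSet_Ico (g := fun _ => (0:ℝ)) h]
  simp

theorem QSM.exists_Tb {γ : ℝ} (hγ : γ ∈ Ioo (0:ℝ) 1) (k a b d : ℝ) (hd : 0 < d) :
    ∃ Tb : ℝ, 0 < Tb ∧ k * Tb ≤ 1 / 2 ∧ a * Tb ≤ d / 4 ∧ b * Tb ≤ d / 16 ∧ 1 / 2 ≤ γ ^ Tb := by
  have ev : ∀ (m : ℝ) (w : ℝ), 0 < w → ∀ᶠ T in nhdsWithin (0:ℝ) (Ioi 0), m * T < w := by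
    intro m w hw
    have : Filter.Tendsto (fun T : ℝ => m * T) (nhds 0) (nhds (m * 0)) :=
      (continuous_const.mul continuous_id).tendsto 0
    rw [mul_zero] at this
    exact (this.eventually_lt_const hw).filter_mono nhdsWithin_le_nhds
  have ev2 : ∀ᶠ T in nhdsWithin (0:ℝ) (Ioi 0), 1 / 2 < γ ^ T := by
    have : Filter.Tendsto (fun T : ℝ => γ ^ T) (nhds 0) (nhds (γ ^ (0:ℝ))) :=
      (QSM.gamma_cont hγ).tendsto 0
    rw [Real.rpow_zero] at this
    exact (this.eventually_const_lt (by norm_num)).filter_mono nhdsWithin_le_nhds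
  obtain ⟨T, h⟩ := ((ev k (1/2) (by norm_num)).and ((ev a (d/4) (by positivity)).and
    ((ev b (d/16) (by positivity)).and (ev2.and self_mem_nhdsWithin)))).exists
  exact ⟨T, h.2.2.2.2, h.1.le, h.2.1.le, h.2.2.1.le, h.2.2.2.1.le⟩

theorem QSM.abstract {γ : ℝ} (hγ : γ ∈ Ioo (0:ℝ) 1) {r : E → ℝ} (hr : Continuous r)
    (hr01 : ∀ q, r q ∈ Icc (0:ℝ) 1) {V : E → E} {K : NNReal} (hV : LipschitzWith K V)
    {z : E → ℝ → E} (hz : QSM.IsFlow V z) {p₀ pst : E} {C δ t₁ : ℝ} (hC : 0 < C) (hδ : 0 < δ)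
    (ht₁ : 0 ≤ t₁)
    (hhit : z p₀ t₁ = pst) (hfirst : ∀ t ∈ Ico 0 t₁, z p₀ t ≠ pst)
    {D : E →L[ℝ] ℝ} (hD : HasFDerivAt (QSM.Qf γ r z) D pst)
    {Lr ρr : ℝ} (hLr : 0 ≤ Lr) (hρr : 0 < ρr)
    (hrL : ∀ q ∈ Metric.closedBall pst ρr, ∀ q' ∈ Metric.closedBall pst ρr,
      |r q - r q'| ≤ Lr * ‖q - q'‖) :
    ∃ ρb, 0 < ρb ∧ ∀ ρ, 0 < ρ → ρ < ρb → ∃ ε, 0 < ε ∧ ε ≤ 1 ∧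
      ∀ W η y (K' : NNReal), LipschitzWith K' W → QSM.Pert V W η y pst C ε ρ →
        (∀ q, δ / 2 * η q ≤ D (W q - V q)) → QSM.Qf γ r z p₀ < QSM.Qf γ r y p₀ := by
  obtain ⟨Tb, hTb, hTb1, hTb2, hTb3, hTb4⟩ :=
    QSM.exists_Tb hγ (K : ℝ) (4 * C * ‖D‖ * K) (4 * C * Lr) δ hδ
  obtain ⟨T, R, M, c, ρb, hT0, hTT, hR, hM, hc, hρb, hesc⟩ :
      ∃ T R M c ρb : ℝ, 0 < T ∧ T ≤ Tb ∧ 0 < R ∧ 0 ≤ M ∧ 0 < c ∧ 0 < ρb ∧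
      ∀ ρ, 0 < ρ → ρ < ρb → ∃ ε, 0 < ε ∧ ε ≤ 1 ∧ ∀ W η y, QSM.Pert V W η y pst C ε ρ →
        QSM.Conc η y z p₀ pst T R M c ρ := by
    by_cases hv : V pst = 0
    · exact QSM.escape_eq hV hz hC ht₁ hhit hfirst hv hTb hTb1
    · exact QSM.escape_neq hV hz hC ht₁ hhit hfirst hv hTb hTb1
  have hK1 : K * T ≤ 1 / 2 := le_trans (by gcongr) hTb1
  have hK2 : 4 * C * ‖D‖ * K * T ≤ δ / 4 := le_trans (by gcongr) hTb2
  have hK3 : 4 * C * Lr * T ≤ δ / 16 := le_trans (by gcongr) hTb3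
  have hK4 : 1 / 2 ≤ γ ^ T := hTb4.trans (Real.rpow_le_rpow_of_exponent_ge hγ.1 hγ.2.le hTT)
  have hq1 : γ ^ T < 1 := Real.rpow_lt_one hγ.1.le hγ.2 hT0
  set R' := R + 4 * C * M with hR'
  have hR'0 : 0 < R' := by positivity
  set κ := δ / 32 * c * (1 - γ ^ T) / (4 * R') with hκ
  have h1q : 0 < 1 - γ ^ T := by linarith
  have hκ0 : 0 < κ := by positivity
  obtain ⟨ρκ, hρκ, hκd⟩ : ∃ ρκ > 0, ∀ q ∈ Metric.closedBall pst ρκ,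
      |QSM.Qf γ r z q - QSM.Qf γ r z pst - D (q - pst)| ≤ κ * ‖q - pst‖ := by
    have := (Asymptotics.isLittleO_iff.1 hD.isLittleO) hκ0
    obtain ⟨ρ, hρ, h⟩ := Metric.nhds_basis_closedBall.eventually_iff.1 this
    exact ⟨ρ, hρ, fun q hq => h hq⟩
  refine ⟨min ρb (min ρκ ρr / R'), lt_min hρb (div_pos (lt_min hρκ hρr) hR'0), fun ρ hρ hρ1 => ?_⟩
  obtain ⟨ε, hε0, hε1, hconc⟩ := hesc ρ hρ (hρ1.trans_le (min_le_left _ _))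
  refine ⟨ε, hε0, hε1, fun W η y K' hW hP hDW => ?_⟩
  obtain ⟨hwin, τ, hτ0, hτ, hτc⟩ := hconc W η y hP
  have hsmall : R' * ρ < min ρκ ρr := by
    have := hρ1.trans_le (min_le_right _ _)
    rw [lt_div_iff₀ hR'0] at this
    linarith
  have hy := hP.flow
  have hWeq : ∀ q, q ∉ Metric.ball pst ρ → W q = V q := fun q hq => by
    have := hP.diff q
    rw [hP.zero q hq, mul_zero] at this
    exact sub_eq_zero.1 (norm_le_zero_iff.1 this)
  set G : E → ℝ := fun p => QSM.Qf γ r y p - QSM.Qf γ r z p with hG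
  have hcont : ∀ p, Continuous fun v => η (y p v) := fun p => hP.cont.comp (hy.cont p)
  have hκe : 0 ≤ 2 * κ * (R' * ρ) := by positivity
  have step : ∀ p, δ / 32 * (∫ v in (0:ℝ)..T, η (y p v)) - 2 * κ * (R' * ρ)
      + γ ^ T * G (y p T) ≤ G p := by
    intro p
    rcases hwin p with hav | ⟨α, β, hα, hαβ, hβ, hav1, hav2, hin, hIM⟩
    · have h1 := QSM.gain_zero hγ hr hr01 hV hW hy hz p hT0.le (fun u hu => hWeq _ (hav u hu))
      have h2 : ∫ v in (0:ℝ)..T, η (y p v) = 0 :=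
        QSM.int_zero hT0.le (fun u hu => hP.zero _ (hav u hu))
      rw [h2]
      simp only [hG]
      rw [h1]
      linarith
    · have h1 := QSM.gain_zero hγ hr hr01 hV hW hy hz p hα (fun u hu => hWeq _ (hav1 u hu))
      set h := β - α with hh
      have hh0 : 0 ≤ h := by linarith
      have hyu : ∀ u, 0 ≤ u → y (y p α) u = y p (α + u) := fun u hu => hy.semigroup hW p hα hu
      have hI : ∫ v in (0:ℝ)..h, η (y (y p α) v) = ∫ v in α..β, η (y p v) := by
        have e := intervalIntegral.integral_comp_add_left (a := 0) (b := h)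
          (fun v => η (y p v)) α
        have e2 : α + h = β := by linarith
        rw [add_zero, e2] at e
        rw [← e]
        refine intervalIntegral.integral_congr (fun u hu => ?_)
        rw [uIcc_of_le hh0] at hu
        simp only [hyu u hu.1]
      have hyR : ∀ u ∈ Icc 0 h, y (y p α) u ∈ Metric.closedBall pst (R * ρ) := fun u hu => by
        rw [hyu u hu.1]; exact hin _ ⟨by linarith [hu.1], by linarith [hu.2]⟩
      have hcmp := QSM.IsFlow.compare hV hy hz (y p α) hC.le hh0
        (le_trans (by gcongr; linarith) hK1) hP.cont hP.nonneg hP.diff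
      rw [hI] at hcmp
      have hRR : R * ρ + 4 * C * (M * ρ) = R' * ρ := by rw [hR']; ring
      have hMp : 0 ≤ 4 * C * (M * ρ) := by positivity
      have h2 := QSM.gain_window hγ hr hr01 hV hW hy hz (C := C) (δ := δ) (T := T) (κ := κ)
        (R := R' * ρ) (Lr := Lr) pst D hC.le hK1 hP.cont hP.nonneg hP.diff hDW hδ hLr hK4 hK2 hK3
        hκ0.le
        (fun q hq q' hq' => hrL q (Metric.closedBall_subset_closedBall
            (hsmall.le.trans (min_le_right _ _)) hq) q' (Metric.closedBall_subset_closedBall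
            (hsmall.le.trans (min_le_right _ _)) hq'))
        (fun q hq => by
          refine (hκd q (Metric.closedBall_subset_closedBall
            (hsmall.le.trans (min_le_left _ _)) hq)).trans ?_
          gcongr
          rwa [Metric.mem_closedBall, dist_eq_norm] at hq)
        (y p α) hh0 (by linarith)
        (fun u hu => Metric.closedBall_subset_closedBall (by linarith) (hyR u hu))
        (fun u hu => by
          have a1 := hyR u hu
          rw [Metric.mem_closedBall, dist_eq_norm] at a1 ⊢
          have a2 := hcmp u hu
          have a3 : 4 * C * (∫ v in α..β, η (y p v)) ≤ 4 * C * (M * ρ) := by gcongr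
          have e : z (y p α) u - pst = (y (y p α) u - pst) - (y (y p α) u - z (y p α) u) := by abel
          rw [e]
          have := norm_sub_le (y (y p α) u - pst) (y (y p α) u - z (y p α) u)
          linarith)
      have e3 : y (y p α) h = y p β := by rw [hyu h hh0]; congr 1; linarith
      rw [hI, e3] at h2
      have hyb : ∀ u, 0 ≤ u → y (y p β) u = y p (β + u) :=
        fun u hu => hy.semigroup hW p (hα.trans hαβ) hu
      have h3 := QSM.gain_zero hγ hr hr01 hV hW hy hz (y p β) (T := T - β) (by linarith)
        (fun u hu => by
          refine hWeq _ ?_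
          rw [hyb u hu.1]
          exact hav2 _ ⟨by linarith [hu.1], by linarith [hu.2]⟩)
      rw [hyb (T - β) (by linarith), show β + (T - β) = T by ring] at h3
      have i := fun a b => (hcont p).intervalIntegrable (μ := volume) a b
      have j1 := intervalIntegral.integral_add_adjacent_intervals (i 0 α) (i α β)
      have j2 := intervalIntegral.integral_add_adjacent_intervals (i 0 β) (i β T)
      have j3 : ∫ v in (0:ℝ)..α, η (y p v) = 0 :=
        QSM.int_zero hα (fun u hu => hP.zero _ (hav1 u hu))
      have j4 : ∫ v in β..T, η (y p v) = 0 :=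
        QSM.int_zero hβ (fun u hu => hP.zero _ (hav2 u hu))
      have hIT : ∫ v in (0:ℝ)..T, η (y p v) = ∫ v in α..β, η (y p v) := by linarith
      rw [hIT]
      have hI0 : 0 ≤ ∫ v in α..β, η (y p v) :=
        intervalIntegral.integral_nonneg hαβ (fun _ _ => hP.nonneg _)
      set I := ∫ v in α..β, η (y p v)
      have hγα : 1 / 2 ≤ γ ^ α :=
        hK4.trans (Real.rpow_le_rpow_of_exponent_ge hγ.1 hγ.2.le (by linarith))
      have hγα1 : γ ^ α ≤ 1 := Real.rpow_le_one hγ.1.le hγ.2.le hα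
      have hγe : γ ^ T = γ ^ α * (γ ^ h * γ ^ (T - β)) := by
        rw [← Real.rpow_add hγ.1, ← Real.rpow_add hγ.1]; congr 1; ring
      rw [h3] at h2
      have h4 := mul_le_mul_of_nonneg_left h2 (show 0 ≤ γ ^ α by linarith)
      simp only [hG]
      rw [h1, hγe]
      have f2 : 1 / 2 * (δ / 16 * I) ≤ γ ^ α * (δ / 16 * I) := by gcongr
      have f3 : γ ^ α * (2 * κ * (R' * ρ)) ≤ 1 * (2 * κ * (R' * ρ)) := by gcongr
      linarith
  have hGB : ∀ p, -(∫ t in Ioi (0:ℝ), γ ^ t) ≤ G p := fun p => by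
    have a1 := (QSM.Q_bound hγ hr hr01 hy.cont p).1
    have a2 := (QSM.Q_bound hγ hr hr01 hz.cont p).2
    simp only [hG]; linarith
  have hinf := QSM.inf_bound (G := G) (Y := fun p => y p T) (e := 2 * κ * (R' * ρ)) (q := γ ^ T)
    (by linarith) hq1 hGB (fun p => by
      have a1 := step p
      have a2 : 0 ≤ ∫ v in (0:ℝ)..T, η (y p v) :=
        intervalIntegral.integral_nonneg hT0.le (fun _ _ => hP.nonneg _)
      have a3 : 0 ≤ δ / 32 * (∫ v in (0:ℝ)..T, η (y p v)) := by positivity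
      linarith)
  have hpos : 0 < G (z p₀ τ) := by
    have a1 := step (z p₀ τ)
    have a2 := hinf (y (z p₀ τ) T)
    have a3 : δ / 32 * (c * ρ) ≤ δ / 32 * (∫ v in (0:ℝ)..T, η (y (z p₀ τ) v)) := by gcongr
    have a4 : γ ^ T * (-(2 * κ * (R' * ρ)) / (1 - γ ^ T)) ≤ γ ^ T * G (y (z p₀ τ) T) := by gcongr
    have a5 : 2 * κ * (R' * ρ) = δ / 32 * (c * ρ) / 2 * (1 - γ ^ T) := by
      rw [hκ]; field_simp; ring
    have a6 : -(2 * κ * (R' * ρ)) / (1 - γ ^ T) = -(δ / 32 * (c * ρ) / 2) := by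
      rw [a5]; field_simp
    rw [a6] at a4
    rw [a5] at a1
    have a7 : 0 < δ / 32 * (c * ρ) := by positivity
    nlinarith
  have hzy := QSM.IsFlow.eq_of_agree hW hz hy p₀ (T := τ)
    (fun u hu => (hWeq _ (hτ u hu)).symm)
  have hfin := QSM.gain_zero hγ hr hr01 hV hW hy hz p₀ hτ0 (fun u hu => by
    rw [← hzy u ⟨hu.1, hu.2.le⟩]; exact hWeq _ (hτ u hu))
  rw [← hzy τ ⟨hτ0, le_rfl⟩] at hfin
  have : 0 < γ ^ τ * G (z p₀ τ) := mul_pos (Real.rpow_pos_of_pos hγ.1 _) hpos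
  simp only [hG] at this
  linarith

end abstractMain

section final

theorem QSM.max_flow {ns na : ℕ}
    {V : EuclideanSpace ℝ (Fin ns) × EuclideanSpace ℝ (Fin na) →
      EuclideanSpace ℝ (Fin ns) × EuclideanSpace ℝ (Fin na)}
    {s : EuclideanSpace ℝ (Fin ns) → EuclideanSpace ℝ (Fin na) → ℝ → EuclideanSpace ℝ (Fin ns)}
    {a : EuclideanSpace ℝ (Fin ns) → EuclideanSpace ℝ (Fin na) → ℝ → EuclideanSpace ℝ (Fin na)}
    (h0 : ∀ s₀ a₀, s s₀ a₀ 0 = s₀ ∧ a s₀ a₀ 0 = a₀)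
    (hd : ∀ s₀ a₀, ∀ t : ℝ, 0 ≤ t →
      HasDerivAt (s s₀ a₀) (V (s s₀ a₀ t, a s₀ a₀ t)).1 t ∧
      HasDerivAt (a s₀ a₀) (V (s s₀ a₀ t, a s₀ a₀ t)).2 t) :
    QSM.IsFlow V (fun p t => (s p.1 p.2 (max t 0), a p.1 p.2 (max t 0))) := by
  have hd' : ∀ p : EuclideanSpace ℝ (Fin ns) × EuclideanSpace ℝ (Fin na), ∀ t : ℝ, 0 ≤ t →
      HasDerivAt (fun t => (s p.1 p.2 t, a p.1 p.2 t)) (V (s p.1 p.2 t, a p.1 p.2 t)) t :=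
    fun p t ht => (hd p.1 p.2 t ht).1.prodMk (hd p.1 p.2 t ht).2
  refine ⟨fun p => ?_, fun p => ?_, fun p t ht => ?_⟩
  · simp [h0]
  · rw [continuous_iff_continuousAt]
    intro t
    have h1 : ContinuousAt (fun t => (s p.1 p.2 t, a p.1 p.2 t)) (max t 0) :=
      (hd' p _ (le_max_right _ _)).continuousAt
    exact ContinuousAt.comp (f := fun t : ℝ => max t 0) h1 (by fun_prop)
  · have h1 := (hd' p t ht).hasDerivWithinAt (s := Ici t)
    simp only [max_eq_left ht]
    refine h1.congr (fun u hu => ?_) ?_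
    · rw [max_eq_left (ht.trans hu)]
    · rw [max_eq_left ht]

theorem QSM.perturb_admissible {ns na : ℕ} {C : ℝ}
    {Ψ : EuclideanSpace ℝ (Fin ns) → EuclideanSpace ℝ (Fin na) → EuclideanSpace ℝ (Fin na)}
    (hΨ : QSM.Admissible C Ψ) {b : EuclideanSpace ℝ (Fin na)} (hb : ‖b‖ ≤ C)
    {η : EuclideanSpace ℝ (Fin ns) × EuclideanSpace ℝ (Fin na) → ℝ}
    (hη : ContDiff ℝ (⊤ : ℕ∞) η) (hηc : HasCompactSupport η) (h0 : ∀ q, 0 ≤ η q)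
    (h1 : ∀ q, η q ≤ 1) :
    QSM.Admissible C (fun s a => Ψ s a + η (s, a) • (b - Ψ s a)) := by
  obtain ⟨hs, ⟨K, hK⟩, hbd⟩ := hΨ
  have hp : ContDiff ℝ (⊤ : ℕ∞) (fun p : EuclideanSpace ℝ (Fin ns) × EuclideanSpace ℝ (Fin na) =>
      η p • (b - Ψ p.1 p.2)) := hη.smul (contDiff_const.sub hs)
  have hpc : HasCompactSupport (fun p : EuclideanSpace ℝ (Fin ns) × EuclideanSpace ℝ (Fin na) =>
      η p • (b - Ψ p.1 p.2)) := hηc.smul_right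
  obtain ⟨K', hK'⟩ := ContDiff.lipschitzWith_of_hasCompactSupport hpc hp (by simp)
  refine ⟨hs.add hp, ⟨K + K', hK.add hK'⟩, fun s a => ?_⟩
  have e : Ψ s a + η (s, a) • (b - Ψ s a) = (1 - η (s, a)) • Ψ s a + η (s, a) • b := by
    module
  show ‖Ψ s a + η (s, a) • (b - Ψ s a)‖ ≤ C
  rw [e]
  refine (norm_add_le _ _).trans ?_
  rw [norm_smul, norm_smul, Real.norm_eq_abs, Real.norm_eq_abs, abs_of_nonneg (h0 _),
    abs_of_nonneg (by linarith [h1 (s, a)])]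
  have := mul_le_mul_of_nonneg_left (hbd s a) (show 0 ≤ 1 - η (s, a) by linarith [h1 (s, a)])
  have := mul_le_mul_of_nonneg_left hb (h0 (s, a))
  linarith

theorem QSM.delta_pos {A : Type*} [NormedAddCommGroup A] [InnerProductSpace ℝ A] {C : ℝ}
    (hC : 0 < C) {g v : A} (hg : g ≠ 0) (hv : ‖v‖ ≤ C) (hne : v ≠ (C / ‖g‖) • g) :
    0 < inner ℝ g ((C / ‖g‖) • g - v) := by
  have hg0 : 0 < ‖g‖ := norm_pos_iff.2 hg
  by_contra hle
  push Not at hle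
  rw [inner_sub_right, inner_smul_right, real_inner_self_eq_norm_sq] at hle
  have e1 : C / ‖g‖ * ‖g‖ ^ 2 = C * ‖g‖ := by field_simp
  rw [e1] at hle
  have h1 : ‖(C / ‖g‖) • g - v‖ ^ 2 ≤ 0 := by
    rw [norm_sub_sq_real, norm_smul, real_inner_smul_left, Real.norm_eq_abs,
      abs_of_pos (by positivity)]
    have e2 : C / ‖g‖ * ‖g‖ = C := by field_simp
    rw [e2]
    have h2 : C / ‖g‖ * (C * ‖g‖) ≤ C / ‖g‖ * inner ℝ g v := by gcongr; linarith
    have e3 : C / ‖g‖ * (C * ‖g‖) = C ^ 2 := by field_simp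
    rw [e3] at h2
    have h3 : ‖v‖ ^ 2 ≤ C ^ 2 := by gcongr
    linarith
  have h2 : ‖(C / ‖g‖) • g - v‖ = 0 := by
    have := sq_nonneg ‖(C / ‖g‖) • g - v‖
    exact pow_eq_zero_iff (two_ne_zero) |>.1 (le_antisymm h1 this)
  exact hne (sub_eq_zero.1 (norm_eq_zero.1 h2)).symm

end final


/-- Theorem 1, optimality condition at the origin: if `Ψ*` maximizes
`J(Ψ) = Q^Ψ(𝟎,𝟎)` over the class of smooth `C`-bounded Lipschitz vector fields, then
along the trajectory of the `Ψ*`-dynamics started at the origin, wherever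
`∇ₐQ^{Ψ*}(s,a) ≠ 0` the score is positively proportional to it:
`Ψ*(s,a) = α_{s,a}·∇ₐQ^{Ψ*}(s,a)` for some `α_{s,a} > 0`. -/
theorem qsm_stmt4 {ns na : ℕ} (γ C : ℝ) (hγ : γ ∈ Set.Ioo (0:ℝ) 1) (hC : 0 < C)
    (F : EuclideanSpace ℝ (Fin ns) → EuclideanSpace ℝ (Fin na) → EuclideanSpace ℝ (Fin ns))
    (hF : ∃ K : NNReal, LipschitzWith K
      (fun p : EuclideanSpace ℝ (Fin ns) × EuclideanSpace ℝ (Fin na) => F p.1 p.2))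
    (r : EuclideanSpace ℝ (Fin ns) → ℝ)
    (hrsmooth : ContDiff ℝ (⊤ : ℕ∞) r) (hr01 : ∀ x, r x ∈ Set.Icc (0:ℝ) 1)
    -- the solution map of the joint dynamics, for each admissible vector field
    (st : (EuclideanSpace ℝ (Fin ns) → EuclideanSpace ℝ (Fin na) →
        EuclideanSpace ℝ (Fin na)) →
      EuclideanSpace ℝ (Fin ns) → EuclideanSpace ℝ (Fin na) → ℝ →
      EuclideanSpace ℝ (Fin ns))
    (ac : (EuclideanSpace ℝ (Fin ns) → EuclideanSpace ℝ (Fin na) →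
        EuclideanSpace ℝ (Fin na)) →
      EuclideanSpace ℝ (Fin ns) → EuclideanSpace ℝ (Fin na) → ℝ →
      EuclideanSpace ℝ (Fin na))
    (hinit : ∀ Ψ, QSM.Admissible C Ψ → ∀ s₀ a₀,
      st Ψ s₀ a₀ 0 = s₀ ∧ ac Ψ s₀ a₀ 0 = a₀)
    (hODE : ∀ Ψ, QSM.Admissible C Ψ → ∀ s₀ a₀, ∀ t : ℝ, 0 ≤ t →
      HasDerivAt (st Ψ s₀ a₀) (F (st Ψ s₀ a₀ t) (ac Ψ s₀ a₀ t)) t ∧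
      HasDerivAt (ac Ψ s₀ a₀) (Ψ (st Ψ s₀ a₀ t) (ac Ψ s₀ a₀ t)) t)
    -- the Q-function of each admissible vector field
    (Q : (EuclideanSpace ℝ (Fin ns) → EuclideanSpace ℝ (Fin na) →
        EuclideanSpace ℝ (Fin na)) →
      EuclideanSpace ℝ (Fin ns) → EuclideanSpace ℝ (Fin na) → ℝ)
    (hQ : ∀ Ψ s₀ a₀, Q Ψ s₀ a₀ = ∫ t in Set.Ioi (0:ℝ), γ ^ t * r (st Ψ s₀ a₀ t))
    -- the maximizer Ψ*
    (Ψstar : EuclideanSpace ℝ (Fin ns) → EuclideanSpace ℝ (Fin na) →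
      EuclideanSpace ℝ (Fin na))
    (hstar : QSM.Admissible C Ψstar)
    (hmax : ∀ Ψ, QSM.Admissible C Ψ → Q Ψ 0 0 ≤ Q Ψstar 0 0)
    -- Q^{Ψ*} is differentiable along the trajectory started at the origin
    (hdiff : ∀ t : ℝ, 0 ≤ t → DifferentiableAt ℝ
      (fun p : EuclideanSpace ℝ (Fin ns) × EuclideanSpace ℝ (Fin na) => Q Ψstar p.1 p.2)
      (st Ψstar 0 0 t, ac Ψstar 0 0 t)) :
    ∀ t : ℝ, 0 ≤ t →
      gradient (fun a' => Q Ψstar (st Ψstar 0 0 t) a') (ac Ψstar 0 0 t) ≠ 0 →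
      ∃ α : ℝ, 0 < α ∧
        Ψstar (st Ψstar 0 0 t) (ac Ψstar 0 0 t) =
          α • gradient (fun a' => Q Ψstar (st Ψstar 0 0 t) a') (ac Ψstar 0 0 t) := by
  intro t ht hg
  obtain ⟨KF, hKF⟩ := hF
  obtain ⟨KΨ, hKΨ⟩ := hstar.2.1
  -- flows
  have hflow : ∀ Ψ, QSM.Admissible C Ψ → QSM.IsFlow
      (fun p : EuclideanSpace ℝ (Fin ns) × EuclideanSpace ℝ (Fin na) => (F p.1 p.2, Ψ p.1 p.2))
      (fun p t => (st Ψ p.1 p.2 (max t 0), ac Ψ p.1 p.2 (max t 0))) := fun Ψ hΨ =>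
    QSM.max_flow (hinit Ψ hΨ) (hODE Ψ hΨ)
  have hQf : ∀ Ψ (p : EuclideanSpace ℝ (Fin ns) × EuclideanSpace ℝ (Fin na)),
      Q Ψ p.1 p.2 = QSM.Qf γ (fun q => r q.1)
        (fun p t => (st Ψ p.1 p.2 (max t 0), ac Ψ p.1 p.2 (max t 0))) p := fun Ψ p => by
    rw [hQ, QSM.Qf]
    refine setIntegral_congr_fun measurableSet_Ioi (fun u hu => ?_)
    simp only [max_eq_left (le_of_lt (mem_Ioi.1 hu))]
  have hz := hflow Ψstar hstar
  set z : EuclideanSpace ℝ (Fin ns) × EuclideanSpace ℝ (Fin na) → ℝ →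
      EuclideanSpace ℝ (Fin ns) × EuclideanSpace ℝ (Fin na) :=
    fun p t => (st Ψstar p.1 p.2 (max t 0), ac Ψstar p.1 p.2 (max t 0)) with hzdef
  set pst : EuclideanSpace ℝ (Fin ns) × EuclideanSpace ℝ (Fin na) :=
    (st Ψstar 0 0 t, ac Ψstar 0 0 t) with hpst
  set g := gradient (fun a' => Q Ψstar (st Ψstar 0 0 t) a') (ac Ψstar 0 0 t) with hgdef
  have hV : LipschitzWith (max KF KΨ)
      (fun p : EuclideanSpace ℝ (Fin ns) × EuclideanSpace ℝ (Fin na) =>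
        (F p.1 p.2, Ψstar p.1 p.2)) := hKF.prodMk hKΨ
  have hg0 : 0 < ‖g‖ := norm_pos_iff.2 hg
  refine ⟨C / ‖g‖, by positivity, ?_⟩
  by_contra hne
  set b := (C / ‖g‖) • g with hb
  have hbn : ‖b‖ ≤ C := by
    rw [hb, norm_smul, Real.norm_eq_abs, abs_of_pos (by positivity)]
    exact (div_mul_cancel₀ _ hg0.ne').le
  have hδ := QSM.delta_pos hC hg (hstar.2.2 _ _) hne
  set δ := inner ℝ g (b - Ψstar (st Ψstar 0 0 t) (ac Ψstar 0 0 t)) with hδdef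
  -- derivative
  have hfun : (fun p : EuclideanSpace ℝ (Fin ns) × EuclideanSpace ℝ (Fin na) =>
      Q Ψstar p.1 p.2) = QSM.Qf γ (fun q => r q.1) z := funext fun p => hQf Ψstar p
  have hD0 := (hdiff t ht).hasFDerivAt
  set D := fderiv ℝ (fun p : EuclideanSpace ℝ (Fin ns) × EuclideanSpace ℝ (Fin na) =>
      Q Ψstar p.1 p.2) pst with hDdef
  have hDg : ∀ v, D (0, v) = inner ℝ g v := fun v => by
    have h1 : HasFDerivAt (fun a' => Q Ψstar (st Ψstar 0 0 t) a')
        (D.comp (ContinuousLinearMap.inr ℝ _ _)) (ac Ψstar 0 0 t) :=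
      hD0.comp (ac Ψstar 0 0 t) (hasFDerivAt_prodMk_right (st Ψstar 0 0 t) (ac Ψstar 0 0 t))
    have h2 := toDual_gradient (𝕜 := ℝ) (f := fun a' => Q Ψstar (st Ψstar 0 0 t) a')
      (x := ac Ψstar 0 0 t)
    rw [h1.fderiv] at h2
    have h3 := congrArg (fun l => l v) h2
    simp only [InnerProductSpace.toDual_apply_apply] at h3
    rw [hgdef, h3]
    simp
  have hD : HasFDerivAt (QSM.Qf γ (fun q => r q.1) z) D pst := by rw [← hfun]; exact hD0
  -- first hitting time
  obtain ⟨t₁, ht₁, hhit, hfirst⟩ : ∃ t₁, 0 ≤ t₁ ∧ z 0 t₁ = pst ∧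
      ∀ u ∈ Ico 0 t₁, z 0 u ≠ pst := by
    have hcl : IsClosed {u : ℝ | 0 ≤ u ∧ z 0 u = pst} :=
      (isClosed_Ici (a := (0:ℝ))).inter (isClosed_eq (hz.cont 0) continuous_const)
    have hne' : {u : ℝ | 0 ≤ u ∧ z 0 u = pst}.Nonempty :=
      ⟨t, ht, by simp [hzdef, hpst, max_eq_left ht]⟩
    have hbd : BddBelow {u : ℝ | 0 ≤ u ∧ z 0 u = pst} := ⟨0, fun u hu => hu.1⟩
    have hmem := hcl.csInf_mem hne' hbd
    exact ⟨_, hmem.1, hmem.2, fun u hu he => absurd (csInf_le hbd ⟨hu.1, he⟩) (not_le.2 hu.2)⟩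
  -- local Lipschitz constant of the reward
  obtain ⟨Lr, ρr, hρr, hrL⟩ : ∃ (Lr : NNReal) (ρr : ℝ), 0 < ρr ∧
      ∀ q ∈ Metric.closedBall pst ρr, ∀ q' ∈ Metric.closedBall pst ρr,
        |r q.1 - r q'.1| ≤ Lr * ‖q - q'‖ := by
    have hc : ContDiff ℝ 1
        (fun q : EuclideanSpace ℝ (Fin ns) × EuclideanSpace ℝ (Fin na) => r q.1) :=
      (hrsmooth.comp contDiff_fst).of_le (by exact_mod_cast le_top)
    obtain ⟨Lr, s, hs, hL⟩ := hc.contDiffAt.exists_lipschitzOnWith (x := pst)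
    obtain ⟨ρr, hρr, hsub⟩ := Metric.nhds_basis_closedBall.mem_iff.1 hs
    refine ⟨Lr, ρr, hρr, fun q hq q' hq' => ?_⟩
    exact hL.norm_sub_le (hsub hq) (hsub hq')
  have hrc : Continuous
      (fun q : EuclideanSpace ℝ (Fin ns) × EuclideanSpace ℝ (Fin na) => r q.1) :=
    hrsmooth.continuous.comp continuous_fst
  obtain ⟨ρb, hρb, hmain⟩ := QSM.abstract hγ hrc (fun q => hr01 q.1) hV hz hC hδ ht₁ hhit hfirst hD
    Lr.2 hρr hrL
  -- positivity of the gain density near the point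
  obtain ⟨ρ₁, hρ₁, hpos⟩ : ∃ ρ₁ > 0, ∀ q ∈ Metric.ball pst ρ₁,
      δ / 2 < inner ℝ g (b - Ψstar q.1 q.2) := by
    have hc : Continuous (fun q : EuclideanSpace ℝ (Fin ns) × EuclideanSpace ℝ (Fin na) =>
        inner ℝ g (b - Ψstar q.1 q.2)) :=
      continuous_const.inner (continuous_const.sub hstar.1.continuous)
    have hev := (hc.tendsto pst).eventually_const_lt (show δ / 2 < _ from half_lt_self hδ)
    obtain ⟨ρ₁, h1, h2⟩ := Metric.nhds_basis_ball.eventually_iff.1 hev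
    exact ⟨ρ₁, h1, fun q hq => h2 hq⟩
  set ρ := min ρb ρ₁ / 2 with hρdef
  have hmin : 0 < min ρb ρ₁ := lt_min hρb hρ₁
  have hρ : 0 < ρ := by positivity
  have hρl : ρ < min ρb ρ₁ := half_lt_self hmin
  obtain ⟨ε, hε0, hε1, hW⟩ := hmain ρ hρ (hρl.trans_le (min_le_left _ _))
  let φ : ContDiffBump pst := ⟨ρ / 2, ρ, by positivity, by linarith⟩
  have hη0 : ∀ q, 0 ≤ ε * φ q := fun q => mul_nonneg hε0.le φ.nonneg
  have hηε : ∀ q, ε * φ q ≤ ε := fun q => mul_le_of_le_one_right hε0.le φ.le_one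
  have hzero : ∀ q, q ∉ Metric.ball pst ρ → ε * φ q = 0 := fun q hq => by
    rw [φ.zero_of_le_dist (by simpa using hq), mul_zero]
  have hadm := QSM.perturb_admissible hstar hbn (η := fun q => ε * φ q)
    (contDiff_const.mul φ.contDiff) (φ.hasCompactSupport.mul_left) hη0
    (fun q => (hηε q).trans hε1)
  have hyf := hflow _ hadm
  obtain ⟨KW, hKW⟩ := hadm.2.1
  have hdiffW : ∀ q : EuclideanSpace ℝ (Fin ns) × EuclideanSpace ℝ (Fin na),
      ((F q.1 q.2, Ψstar q.1 q.2 + (ε * φ (q.1, q.2)) • (b - Ψstar q.1 q.2)) :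
        EuclideanSpace ℝ (Fin ns) × EuclideanSpace ℝ (Fin na)) - (F q.1 q.2, Ψstar q.1 q.2)
      = (0, (ε * φ q) • (b - Ψstar q.1 q.2)) := fun q => by
    ext1 <;> simp
  have hlt := hW _ (fun q => ε * φ q) _ (max KF KW) (hKF.prodMk hKW)
    ⟨continuous_const.mul φ.continuous, hη0, hηε, fun q hq => by
        rw [φ.one_of_mem_closedBall hq, mul_one],
      hzero, fun q => by
        rw [hdiffW q, Prod.norm_mk, norm_zero, max_eq_right (norm_nonneg _), norm_smul,
          Real.norm_eq_abs, abs_of_nonneg (hη0 q)]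
        have h1 := norm_sub_le b (Ψstar q.1 q.2)
        have h2 := hstar.2.2 q.1 q.2
        have h3 := mul_le_mul_of_nonneg_left (show ‖b - Ψstar q.1 q.2‖ ≤ 2 * C by linarith) (hη0 q)
        linarith, hyf⟩
    (fun q => by
      rw [hdiffW q, hDg, inner_smul_right]
      by_cases hq : q ∈ Metric.ball pst ρ
      · have h1 := hpos q (Metric.ball_subset_ball (hρl.le.trans (min_le_right _ _)) hq)
        have h3 := mul_le_mul_of_nonneg_left h1.le (hη0 q)
        linarith
      · rw [hzero q hq]; simp)
  have h1 := hmax _ hadm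
  have h2 := hQf Ψstar 0
  have h4 := hQf (fun s a => Ψstar s a + (ε * φ (s, a)) • (b - Ψstar s a)) 0
  simp only [Prod.fst_zero, Prod.snd_zero] at h2 h4
  rw [h2, h4] at h1
  exact absurd hlt (not_lt.2 h1)
end

section
/- Let γ ∈ (0,1), C > 0, let F : ℝ^s × ℝ^a → ℝ^s be globally Lipschitz, and let r : ℝ^s → [0,1] be smooth. Let Ψ : ℝ^s × ℝ^a → ℝ^a be a smooth Lipschitz vector field with ‖Ψ(s,a)‖₂ ≤ C for all (s,a), and suppose Q^Ψ is differentiable at the origin. Suppose ∇_a Q^Ψ(𝟎,𝟎) ≠ 𝟎 and that Ψ(𝟎,𝟎) is not a positive scalar multiple of ∇_a Q^Ψ(𝟎,𝟎) (i.e., there is no α > 0 with Ψ(𝟎,𝟎) = α·∇_a Q^Ψ(𝟎,𝟎)). Then there exists a smooth Lipschitz vector field Ψ' : ℝ^s × ℝ^a → ℝ^a with ‖Ψ'(s,a)‖₂ ≤ C for all (s,a) such that Q^{Ψ'}(𝟎,𝟎) > Q^Ψ(𝟎,𝟎). -/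
open MeasureTheory Real Set

namespace QSMaux
open Filter Topology

set_option linter.unusedSectionVars false

variable {X : Type*} [NormedAddCommGroup X] [NormedSpace ℝ X]

structure IsSol (v : X → X) (z : ℝ → X) : Prop where
  cont : Continuous z
  der : ∀ t, 0 ≤ t → HasDerivWithinAt z (v (z t)) (Ici t) t

structure IsFlow (v : X → X) (Φ : X → ℝ → X) : Prop where
  sol : ∀ x, IsSol v (Φ x)
  init : ∀ x, Φ x 0 = x

noncomputable def J (γ : ℝ) (r : X → ℝ) (z : ℝ → X) : ℝ := ∫ t in Ioi (0:ℝ), γ ^ t * r (z t)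

lemma cont_rpow {γ : ℝ} (h0 : 0 < γ) : Continuous (fun t : ℝ => γ ^ t) :=
  Real.continuous_const_rpow h0.ne'

lemma integrable_rpow {γ : ℝ} (h0 : 0 < γ) (h1 : γ < 1) (c : ℝ) :
    IntegrableOn (fun t : ℝ => γ ^ t) (Ioi c) := by
  have := integrableOn_exp_mul_Ioi (Real.log_neg h0 h1) c
  refine this.congr_fun (fun t _ => ?_) measurableSet_Ioi
  simp only [Real.rpow_def_of_pos h0]

lemma integrable_J {γ : ℝ} (h0 : 0 < γ) (h1 : γ < 1) {r : X → ℝ} (hr : Continuous r)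
    (hr01 : ∀ x, r x ∈ Icc (0:ℝ) 1) {z : ℝ → X} (hz : Continuous z) (c : ℝ) :
    IntegrableOn (fun t : ℝ => γ ^ t * r (z t)) (Ioi c) := by
  refine Integrable.mono' (integrable_rpow h0 h1 c)
    (((cont_rpow h0).mul (hr.comp hz)).aestronglyMeasurable) (Eventually.of_forall fun t => ?_)
  have h := hr01 (z t)
  have hp := Real.rpow_pos_of_pos h0 t
  rw [Real.norm_of_nonneg (mul_nonneg hp.le h.1)]
  exact mul_le_of_le_one_right hp.le h.2

lemma J_nonneg {γ : ℝ} (h0 : 0 < γ) {r : X → ℝ}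
    (hr01 : ∀ x, r x ∈ Icc (0:ℝ) 1) (z : ℝ → X) : 0 ≤ J γ r z :=
  integral_nonneg fun t => mul_nonneg (Real.rpow_pos_of_pos h0 t).le (hr01 _).1

lemma J_le {γ : ℝ} (h0 : 0 < γ) (h1 : γ < 1) {r : X → ℝ} (hr : Continuous r)
    (hr01 : ∀ x, r x ∈ Icc (0:ℝ) 1) {z : ℝ → X} (hz : Continuous z) :
    J γ r z ≤ ∫ t in Ioi (0:ℝ), γ ^ t := by
  refine integral_mono (integrable_J h0 h1 hr hr01 hz 0) (integrable_rpow h0 h1 0) fun t => ?_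
  exact mul_le_of_le_one_right (Real.rpow_pos_of_pos h0 t).le (hr01 _).2

lemma J_split {γ : ℝ} (h0 : 0 < γ) (h1 : γ < 1) {r : X → ℝ} (hr : Continuous r)
    (hr01 : ∀ x, r x ∈ Icc (0:ℝ) 1) {z : ℝ → X} (hz : Continuous z) (τ : ℝ) :
    J γ r z = (∫ t in (0:ℝ)..τ, γ ^ t * r (z t)) + γ ^ τ * J γ r (fun t => z (t + τ)) := by
  unfold J
  rw [← intervalIntegral.integral_interval_add_Ioi (integrable_J h0 h1 hr hr01 hz 0)
    (integrable_J h0 h1 hr hr01 hz τ)]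
  congr 1
  rw [← integral_const_mul]
  have h := (measurePreserving_add_right (volume : Measure ℝ) τ).setIntegral_preimage_emb
    (measurableEmbedding_addRight τ) (fun t : ℝ => γ ^ t * r (z t)) (Ioi τ)
  rw [← h]
  simp only [Set.preimage_add_const_Ioi, sub_self]
  refine setIntegral_congr_fun measurableSet_Ioi fun t _ => ?_
  simp only [Real.rpow_add h0]
  ring

lemma J_congr {γ : ℝ} {r : X → ℝ} {z w : ℝ → X} (h : ∀ t, 0 ≤ t → z t = w t) :
    J γ r z = J γ r w := by
  refine setIntegral_congr_fun measurableSet_Ioi fun t ht => ?_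
  simp only [h t (le_of_lt ht)]

lemma uniq {v : X → X} {K : NNReal} (hv : LipschitzWith K v) {z w : ℝ → X} {T : ℝ}
    (hz : Continuous z) (hw : Continuous w)
    (hz' : ∀ t ∈ Ico (0:ℝ) T, HasDerivWithinAt z (v (z t)) (Ici t) t)
    (hw' : ∀ t ∈ Ico (0:ℝ) T, HasDerivWithinAt w (v (w t)) (Ici t) t)
    (h : z 0 = w 0) : ∀ t ∈ Icc (0:ℝ) T, z t = w t := by
  intro t ht
  have := dist_le_of_trajectories_ODE (v := fun _ => v) (δ := 0) (fun _ => hv) hz.continuousOn hz'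
    hw.continuousOn hw' (by simp [h]) t ht
  simpa using this

lemma IsSol.shift {v : X → X} {z : ℝ → X} (h : IsSol v z) {τ : ℝ} (hτ : 0 ≤ τ) :
    IsSol v (fun t => z (t + τ)) := by
  refine ⟨h.cont.comp (by fun_prop), fun t ht => ?_⟩
  have h1 := h.der (t + τ) (by positivity)
  have h2 : HasDerivWithinAt (fun t : ℝ => t + τ) 1 (Ici t) t :=
    ((hasDerivAt_id t).add_const τ).hasDerivWithinAt
  have := HasDerivWithinAt.scomp t h1 h2 (fun s hs => by
    simp only [mem_Ici] at hs ⊢; linarith)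
  rw [one_smul] at this
  exact this

lemma IsFlow.semi {v : X → X} {Φ : X → ℝ → X} (h : IsFlow v Φ) {K : NNReal}
    (hv : LipschitzWith K v) (x : X) {τ : ℝ} (hτ : 0 ≤ τ) {t : ℝ} (ht : 0 ≤ t) :
    Φ x (t + τ) = Φ (Φ x τ) t := by
  refine uniq hv ((h.sol x).shift hτ).cont (h.sol _).cont
    (fun s hs => ((h.sol x).shift hτ).der s hs.1) (fun s hs => (h.sol _).der s hs.1)
    (T := t) ?_ t ⟨ht, le_rfl⟩
  simp [h.init]

lemma J_flow {γ : ℝ} (h0 : 0 < γ) (h1 : γ < 1) {r : X → ℝ} (hr : Continuous r)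
    (hr01 : ∀ x, r x ∈ Icc (0:ℝ) 1) {v : X → X} {Φ : X → ℝ → X} (h : IsFlow v Φ) {K : NNReal}
    (hv : LipschitzWith K v) (x : X) {τ : ℝ} (hτ : 0 ≤ τ) :
    J γ r (Φ x) = (∫ t in (0:ℝ)..τ, γ ^ t * r (Φ x t)) + γ ^ τ * J γ r (Φ (Φ x τ)) := by
  rw [J_split h0 h1 hr hr01 (h.sol x).cont τ]
  congr 2
  exact J_congr fun t ht => h.semi hv x hτ ht

/-- if the perturbation vanishes along either trajectory, they coincide -/
lemma agree {v b : X → X} {K : NNReal} (hv : LipschitzWith K v)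
    {z w : ℝ → X} (hz : IsSol v z) (hw : IsSol (fun x => v x + b x) w) (h : z 0 = w 0) {T : ℝ}
    (hb : ∀ t ∈ Ico (0:ℝ) T, b (w t) = 0) : ∀ t ∈ Icc (0:ℝ) T, z t = w t := by
  refine uniq hv hz.cont hw.cont (fun t ht => hz.der t ht.1) (fun t ht => ?_) h
  have := hw.der t ht.1
  simpa [hb t ht] using this

lemma agree' {v b : X → X} {K : NNReal} (hv : LipschitzWith K (fun x => v x + b x))
    {z w : ℝ → X} (hz : IsSol v z) (hw : IsSol (fun x => v x + b x) w) (h : z 0 = w 0) {T : ℝ}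
    (hb : ∀ t ∈ Ico (0:ℝ) T, b (z t) = 0) : ∀ t ∈ Icc (0:ℝ) T, z t = w t := by
  refine uniq hv hz.cont hw.cont (fun t ht => ?_) (fun t ht => hw.der t ht.1) h
  have := hz.der t ht.1
  simpa [hb t ht] using this

/-- Difference identity over a stretch where both flows agree. -/
lemma diff_agree {γ : ℝ} (h0 : 0 < γ) (h1 : γ < 1) {r : X → ℝ} (hr : Continuous r)
    (hr01 : ∀ x, r x ∈ Icc (0:ℝ) 1) {v v' : X → X} {Φ Φ' : X → ℝ → X} (h : IsFlow v Φ)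
    (h' : IsFlow v' Φ') {K K' : NNReal}
    (hv : LipschitzWith K v) (hv' : LipschitzWith K' v') (x : X) {τ : ℝ} (hτ : 0 ≤ τ)
    (he : ∀ t ∈ Icc (0:ℝ) τ, Φ x t = Φ' x t) :
    J γ r (Φ' x) - J γ r (Φ x) = γ ^ τ * (J γ r (Φ' (Φ' x τ)) - J γ r (Φ (Φ' x τ))) := by
  rw [J_flow h0 h1 hr hr01 h hv x hτ, J_flow h0 h1 hr hr01 h' hv' x hτ, he τ ⟨hτ, le_rfl⟩]
  have : (∫ t in (0:ℝ)..τ, γ ^ t * r (Φ x t)) = ∫ t in (0:ℝ)..τ, γ ^ t * r (Φ' x t) := by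
    refine intervalIntegral.integral_congr fun t ht => ?_
    rw [uIcc_of_le hτ] at ht
    simp only [he t ht]
  rw [this]; ring

/-- First entry. -/
lemma entry {γ : ℝ} (h0 : 0 < γ) (h1 : γ < 1) {r : X → ℝ} (hr : Continuous r)
    (hr01 : ∀ x, r x ∈ Icc (0:ℝ) 1) {v b : X → X} {Φ Φ' : X → ℝ → X} (h : IsFlow v Φ)
    (h' : IsFlow (fun x => v x + b x) Φ') {K K' : NNReal}
    (hv : LipschitzWith K v) (hv' : LipschitzWith K' (fun x => v x + b x)) {ε : ℝ}
    (hb : ∀ x, ε ≤ ‖x‖ → b x = 0) (x : X) :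
    (∃ y, ‖y‖ ≤ ε ∧ ∃ g ∈ Icc (0:ℝ) 1,
      J γ r (Φ' x) - J γ r (Φ x) = g * (J γ r (Φ' y) - J γ r (Φ y))) ∨
      J γ r (Φ' x) - J γ r (Φ x) = 0 := by
  by_cases hE : ∃ t, 0 ≤ t ∧ ‖Φ' x t‖ ≤ ε
  · left
    let S : Set ℝ := {t | 0 ≤ t ∧ ‖Φ' x t‖ ≤ ε}
    have hS : IsClosed S := (isClosed_le continuous_const continuous_id).inter
      (isClosed_le ((h'.sol x).cont.norm) continuous_const)
    have hbd : BddBelow S := ⟨0, fun t ht => ht.1⟩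
    have hm : sInf S ∈ S := hS.csInf_mem hE hbd
    refine ⟨Φ' x (sInf S), hm.2, γ ^ (sInf S), ⟨(Real.rpow_pos_of_pos h0 _).le,
      Real.rpow_le_one h0.le h1.le hm.1⟩, ?_⟩
    refine diff_agree h0 h1 hr hr01 h h' hv hv' x hm.1 (agree hv (h.sol x) (h'.sol x)
      (by rw [h.init, h'.init]) fun t ht => hb _ ?_)
    by_contra hcon
    exact absurd (csInf_le hbd (show t ∈ S from ⟨ht.1, (not_le.mp hcon).le⟩)) (not_le.mpr ht.2)
  · right
    push Not at hE
    have : J γ r (Φ x) = J γ r (Φ' x) := J_congr fun t ht =>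
      agree hv (h.sol x) (h'.sol x) (T := t)
      (by rw [h.init, h'.init]) (fun s hs => hb _ (hE s hs.1).le) t ⟨ht, le_rfl⟩
    rw [this, sub_self]

/-- abstract renewal -/
lemma renewal {γ : ℝ} (h0 : 0 < γ) (h1 : γ < 1) {Δ : X → ℝ} {ε h δ e A : ℝ} (hh : 0 < h)
    (hδ : 0 < δ) (he : 0 ≤ e) (hbd : ∃ M, ∀ x, M ≤ Δ x)
    (hstep : ∀ m ≤ 0, (∀ x, m ≤ Δ x) → ∀ x, ‖x‖ ≤ ε → min (γ ^ h * m) (-e + γ ^ δ * m) ≤ Δ x)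
    (hent : ∀ x, (∃ y, ‖y‖ ≤ ε ∧ ∃ g ∈ Icc (0:ℝ) 1, Δ x = g * Δ y) ∨ Δ x = 0)
    (hfirst : ∀ m ≤ 0, (∀ x, m ≤ Δ x) → A - e + m ≤ Δ 0) :
    A - e - e / (1 - γ ^ δ) ≤ Δ 0 := by
  have hγδ : γ ^ δ < 1 := Real.rpow_lt_one h0.le h1 hδ
  have hγδ0 : 0 < γ ^ δ := Real.rpow_pos_of_pos h0 _
  have hγh : γ ^ h < 1 := Real.rpow_lt_one h0.le h1 hh
  have hγh0 : 0 < γ ^ h := Real.rpow_pos_of_pos h0 _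
  obtain ⟨M, hM⟩ := hbd
  have hbdd : BddBelow (range Δ) := ⟨M, by rintro _ ⟨x, rfl⟩; exact hM x⟩
  set m := min (sInf (range Δ)) 0 with hm
  have hm0 : m ≤ 0 := min_le_right _ _
  have hmΔ : ∀ x, m ≤ Δ x := fun x => (min_le_left _ _).trans (csInf_le hbdd ⟨x, rfl⟩)
  set q := min (γ ^ h * m) (-e + γ ^ δ * m) with hq
  have hq0 : q ≤ 0 := (min_le_left _ _).trans (by nlinarith)
  have hqΔ : ∀ x, q ≤ Δ x := by
    intro x
    rcases hent x with ⟨y, hy, g, hg, hxy⟩ | hx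
    · have := hstep m hm0 hmΔ y hy
      rw [hxy]
      nlinarith [hg.1, hg.2]
    · rw [hx]; exact hq0
  have hqm : q ≤ m := le_min (le_csInf ⟨_, ⟨0, rfl⟩⟩ (by rintro _ ⟨x, rfl⟩; exact hqΔ x)) hq0
  have hme : -(e / (1 - γ ^ δ)) ≤ m := by
    have hp : 0 ≤ e / (1 - γ ^ δ) := div_nonneg he (by linarith)
    rcases min_le_iff.mp (hq ▸ hqm) with h | h
    · have : 0 ≤ m := by nlinarith
      linarith
    · rw [← neg_div, div_le_iff₀ (by linarith)]
      linarith
  have := hfirst m hm0 hmΔ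
  linarith

lemma stay {f : X → X} {N K M ρ T : ℝ} (hf : ∀ p, ‖f p‖ ≤ N + K * ‖p‖) (hM : N + 2 ≤ M)
    (hK : 0 ≤ K) (hM0 : 0 ≤ M)
    {w : ℝ → X} (hw : IsSol f w) (h0 : ‖w 0‖ ≤ ρ) (hT : K * (ρ + M * T) ≤ 1) :
    ∀ t ∈ Icc (0:ℝ) T, ‖w t‖ ≤ ρ + M * t := by
  intro t ht
  refine image_norm_le_of_norm_deriv_right_lt_deriv_boundary (f := w) (f' := fun t => f (w t))
    (B := fun t => ρ + M * t) (B' := fun _ => M)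
    hw.cont.continuousOn (fun s hs => hw.der s hs.1) (by simpa using h0) (fun s => ?_)
    (fun s hs he => ?_) ht
  · simpa using ((hasDerivAt_id s).const_mul M).const_add ρ
  · have h1 := hf (w s)
    rw [he] at h1
    have : K * (ρ + M * s) ≤ K * (ρ + M * T) := by
      have := hs.2.le
      gcongr
    show ‖f (w s)‖ < M
    linarith

lemma stay0 {f : X → X} {K ε T : ℝ} (hK : 0 ≤ K) (hε : 0 < ε)
    (hf : ∀ p, ε ≤ ‖p‖ → ‖f p‖ ≤ K * ‖p‖)
    {w : ℝ → X} (hw : IsSol f w) (h0 : ‖w 0‖ ≤ ε) (hT : Real.exp ((K + 1) * T) ≤ 2) :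
    ∀ t ∈ Icc (0:ℝ) T, ‖w t‖ ≤ 2 * ε := by
  intro t ht
  have h : ‖w t‖ ≤ ε * Real.exp ((K + 1) * t) := by
    refine image_norm_le_of_norm_deriv_right_lt_deriv_boundary (f := w) (f' := fun t => f (w t))
      (B := fun t => ε * Real.exp ((K + 1) * t))
      (B' := fun t => ε * (Real.exp ((K + 1) * t) * (K + 1)))
      hw.cont.continuousOn (fun s hs => hw.der s hs.1) (by simpa using h0) (fun s => ?_)
      (fun s hs he => ?_) ht
    · have := (((hasDerivAt_id s).const_mul (K + 1)).exp).const_mul ε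
      simpa using this
    · have h1 : ε ≤ ‖w s‖ := by
        rw [he]
        have : 1 ≤ Real.exp ((K + 1) * s) :=
          Real.one_le_exp (mul_nonneg (by linarith) hs.1)
        nlinarith
      have h2 := hf (w s) h1
      have h3 : 0 < ‖w s‖ := by linarith
      have h4 : ε * (Real.exp ((K + 1) * s) * (K + 1)) = (K + 1) * ‖w s‖ := by rw [he]; ring
      show ‖f (w s)‖ < _
      rw [h4]
      linarith
  have h2 : Real.exp ((K + 1) * t) ≤ Real.exp ((K + 1) * T) := by
    have := ht.2
    gcongr
  nlinarith

structure Data (γ : ℝ) (r : X → ℝ) (v b : X → X) (Φ Φ' : X → ℝ → X) (χ : X → ℝ)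
    (K K' : NNReal) (D c ε : ℝ) (L : X →L[ℝ] ℝ) : Prop where
  h0 : 0 < γ
  h1 : γ < 1
  hr : Continuous r
  hr01 : ∀ x, r x ∈ Icc (0:ℝ) 1
  fl : IsFlow v Φ
  fl' : IsFlow (fun x => v x + b x) Φ'
  hv : LipschitzWith K v
  hv' : LipschitzWith K' (fun x => v x + b x)
  hK : 1 ≤ (K : ℝ)
  hD : 0 < D
  hc : 0 < c
  hε : 0 < ε
  χc : Continuous χ
  bc : Continuous b
  χ0 : ∀ p, 0 ≤ χ p
  χle : ∀ p, χ p ≤ 1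
  χ1 : ∀ p, ‖p‖ ≤ ε / 2 → χ p = 1
  χz : ∀ p, ε ≤ ‖p‖ → χ p = 0
  bD : ∀ p, ‖b p‖ ≤ D * χ p
  bL : ∀ p, c * χ p ≤ L (b p)

variable {γ : ℝ} {r : X → ℝ} {v b : X → X} {Φ Φ' : X → ℝ → X} {χ : X → ℝ}
    {K K' : NNReal} {D c ε : ℝ} {L : X →L[ℝ] ℝ}

lemma Data.bz (d : Data γ r v b Φ Φ' χ K K' D c ε L) (p : X) (hp : ε ≤ ‖p‖) : b p = 0 := by
  have := d.bD p
  rw [d.χz p hp, mul_zero] at this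
  exact norm_le_zero_iff.mp this

lemma Data.vbound (d : Data γ r v b Φ Φ' χ K K' D c ε L) (p : X) : ‖v p‖ ≤ ‖v 0‖ + K * ‖p‖ := by
  have h := d.hv.dist_le_mul p 0
  rw [dist_eq_norm, dist_zero_right] at h
  have := norm_sub_norm_le (v p) (v 0)
  linarith

variable [CompleteSpace X]

lemma Data.perturb (d : Data γ r v b Φ Φ' χ K K' D c ε L) (x : X) {T t : ℝ}
    (ht : t ∈ Icc (0:ℝ) T) :
    ‖Φ' x t - Φ x t - ∫ s in (0:ℝ)..t, b (Φ' x s)‖ ≤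
      D * (∫ s in (0:ℝ)..T, χ (Φ' x s)) * (Real.exp (K * T) - 1) ∧
    ‖∫ s in (0:ℝ)..t, b (Φ' x s)‖ ≤ D * (∫ s in (0:ℝ)..T, χ (Φ' x s)) := by
  have hw := d.fl'.sol x
  have hz := d.fl.sol x
  have hbw : Continuous fun s => b (Φ' x s) := d.bc.comp hw.cont
  have hχw : Continuous fun s => χ (Φ' x s) := d.χc.comp hw.cont
  set I := ∫ s in (0:ℝ)..T, χ (Φ' x s) with hI
  have hB : ∀ t, HasDerivAt (fun t => ∫ s in (0:ℝ)..t, b (Φ' x s)) (b (Φ' x t)) t := fun t =>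
    (hbw.integral_hasStrictDerivAt 0 t).hasDerivAt
  have hBn : ∀ t ∈ Icc (0:ℝ) T, ‖∫ s in (0:ℝ)..t, b (Φ' x s)‖ ≤ D * I := by
    intro t ht
    calc ‖∫ s in (0:ℝ)..t, b (Φ' x s)‖ ≤ ∫ s in (0:ℝ)..t, D * χ (Φ' x s) :=
          intervalIntegral.norm_integral_le_of_norm_le ht.1
            (Eventually.of_forall fun s _ => d.bD _)
            ((continuous_const.mul hχw).intervalIntegrable _ _)
      _ = D * ∫ s in (0:ℝ)..t, χ (Φ' x s) := intervalIntegral.integral_const_mul _ _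
      _ ≤ D * I := by
          refine mul_le_mul_of_nonneg_left ?_ d.hD.le
          refine intervalIntegral.integral_mono_interval le_rfl ht.1 ht.2
            (Eventually.of_forall fun s => d.χ0 _) (hχw.intervalIntegrable _ _)
  refine ⟨?_, hBn t ht⟩
  have hKpos : (0:ℝ) < K := by linarith [d.hK]
  have key := dist_le_of_approx_trajectories_ODE (v := fun _ => v) (K := K) (a := 0) (b := T)
    (f := fun t => Φ' x t - ∫ s in (0:ℝ)..t, b (Φ' x s)) (f' := fun t => v (Φ' x t))
    (g := Φ x) (g' := fun t => v (Φ x t)) (εf := K * (D * I)) (εg := 0) (δ := 0)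
    (fun _ => d.hv)
    ((hw.cont.sub (continuous_iff_continuousAt.mpr fun t => (hB t).continuousAt)).continuousOn)
    (fun t ht => by
      have := (hw.der t ht.1).sub (hB t).hasDerivWithinAt
      rw [add_sub_cancel_right] at this
      exact this)
    (fun t ht => by
      refine (d.hv.dist_le_mul _ _).trans ?_
      refine mul_le_mul_of_nonneg_left ?_ hKpos.le
      rw [dist_eq_norm, sub_sub_cancel]
      exact hBn t ⟨ht.1, ht.2.le⟩)
    hz.cont.continuousOn (fun t ht => hz.der t ht.1) (fun t _ => by simp)
    (by simp [d.fl.init, d.fl'.init]) t ht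
  rw [dist_eq_norm, gronwallBound_of_K_ne_0 hKpos.ne'] at key
  have hI0 : 0 ≤ D * I := (norm_nonneg _).trans (hBn t ht)
  have e1 : Φ' x t - (∫ s in (0:ℝ)..t, b (Φ' x s)) - Φ x t
      = Φ' x t - Φ x t - ∫ s in (0:ℝ)..t, b (Φ' x s) := by abel
  rw [e1] at key
  refine key.trans ?_
  beta_reduce
  have e2 : Real.exp (K * (t - 0)) ≤ Real.exp (K * T) := by
    have := ht.2
    rw [sub_zero]; gcongr
  have e3 : K * (D * I) + 0 = K * (D * I) := add_zero _
  rw [e3, mul_div_cancel_left₀ _ hKpos.ne', zero_mul, zero_add]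
  exact mul_le_mul_of_nonneg_left (by linarith) hI0

lemma Data.dist_le (d : Data γ r v b Φ Φ' χ K K' D c ε L) (x : X) {T t : ℝ}
    (hT : Real.exp (K * T) ≤ 2) (ht : t ∈ Icc (0:ℝ) T) :
    ‖Φ' x t - Φ x t‖ ≤ 2 * D * (∫ s in (0:ℝ)..T, χ (Φ' x s)) := by
  obtain ⟨h1, h2⟩ := d.perturb x ht
  have h3 := norm_add_le (Φ' x t - Φ x t - ∫ s in (0:ℝ)..t, b (Φ' x s))
    (∫ s in (0:ℝ)..t, b (Φ' x s))
  rw [sub_add_cancel] at h3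
  have h4 : 0 ≤ D * (∫ s in (0:ℝ)..T, χ (Φ' x s)) := (norm_nonneg _).trans h2
  nlinarith

lemma Data.step (d : Data γ r v b Φ Φ' χ K K' D c ε L) (x : X) {δ τ ρ R θ : ℝ} {Lr : NNReal}
    (hτ : τ ∈ Icc (0:ℝ) δ)
    (hδ1 : Real.exp (K * δ) ≤ 2)
    (hδ2 : ‖L‖ * D * (Real.exp (K * δ) - 1) ≤ c / 4)
    (hδ3 : δ * (Lr * (2 * D)) ≤ c / 8) (hδ4 : 1 / 2 ≤ γ ^ δ)
    (hrL : LipschitzOnWith Lr r (Metric.closedBall 0 ρ))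
    (hz : ∀ t ∈ Icc (0:ℝ) τ, ‖Φ x t‖ ≤ ρ) (hw : ∀ t ∈ Icc (0:ℝ) τ, ‖Φ' x t‖ ≤ ρ)
    (hzR : ‖Φ x τ‖ ≤ R) (hwR : ‖Φ' x τ‖ ≤ R) (hθ : 0 ≤ θ)
    (hV : ∀ p, ‖p‖ ≤ R → |J γ r (Φ p) - J γ r (Φ 0) - L p| ≤ θ * ‖p‖) :
    c / 4 * (∫ s in (0:ℝ)..τ, χ (Φ' x s)) - 2 * θ * R
      + γ ^ τ * (J γ r (Φ' (Φ' x τ)) - J γ r (Φ (Φ' x τ)))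
      ≤ J γ r (Φ' x) - J γ r (Φ x) := by
  have hbw : Continuous fun s => b (Φ' x s) := d.bc.comp (d.fl'.sol x).cont
  have hχw : Continuous fun s => χ (Φ' x s) := d.χc.comp (d.fl'.sol x).cont
  have hexp : Real.exp (K * τ) ≤ Real.exp (K * δ) := by
    have := hτ.2
    gcongr
  obtain ⟨p1, p2⟩ := d.perturb x (T := τ) (t := τ) ⟨hτ.1, le_rfl⟩
  have hdist := fun t ht => d.dist_le x (T := τ) (t := t) (hexp.trans hδ1) ht
  set I := ∫ s in (0:ℝ)..τ, χ (Φ' x s) with hI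
  have hI0 : 0 ≤ I := intervalIntegral.integral_nonneg hτ.1 fun s _ => d.χ0 _
  -- integral term
  have i1 : |(∫ t in (0:ℝ)..τ, γ ^ t * r (Φ' x t)) - ∫ t in (0:ℝ)..τ, γ ^ t * r (Φ x t)|
      ≤ c / 8 * I := by
    have c1 : Continuous fun t : ℝ => γ ^ t * r (Φ' x t) :=
      (cont_rpow d.h0).mul (d.hr.comp (d.fl'.sol x).cont)
    have c2 : Continuous fun t : ℝ => γ ^ t * r (Φ x t) :=
      (cont_rpow d.h0).mul (d.hr.comp (d.fl.sol x).cont)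
    rw [← intervalIntegral.integral_sub (c1.intervalIntegrable _ _) (c2.intervalIntegrable _ _)]
    have := intervalIntegral.norm_integral_le_of_norm_le_const (a := 0) (b := τ)
      (f := fun t => γ ^ t * r (Φ' x t) - γ ^ t * r (Φ x t)) (C := Lr * (2 * D * I)) ?_
    · rw [Real.norm_eq_abs, sub_zero, abs_of_nonneg hτ.1] at this
      refine this.trans ?_
      have h5 : τ * (Lr * (2 * D)) ≤ c / 8 := by
        refine le_trans ?_ hδ3
        have := d.hD
        have := hτ.2
        gcongr
      nlinarith
    · intro t ht
      rw [uIoc_of_le hτ.1] at ht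
      have ht' : t ∈ Icc (0:ℝ) τ := ⟨ht.1.le, ht.2⟩
      have h6 := hrL.dist_le_mul (Φ' x t) (by simpa using hw t ht') (Φ x t) (by simpa using hz t ht')
      rw [dist_eq_norm, dist_eq_norm] at h6
      have h7 : γ ^ t ≤ 1 := Real.rpow_le_one d.h0.le d.h1.le ht'.1
      have h8 : 0 < γ ^ t := Real.rpow_pos_of_pos d.h0 t
      rw [← mul_sub, norm_mul, Real.norm_of_nonneg h8.le]
      calc γ ^ t * ‖r (Φ' x t) - r (Φ x t)‖ ≤ 1 * ‖r (Φ' x t) - r (Φ x t)‖ := by gcongr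
        _ ≤ Lr * ‖Φ' x t - Φ x t‖ := by rw [one_mul]; exact h6
        _ ≤ Lr * (2 * D * I) := mul_le_mul_of_nonneg_left (hdist t ht') Lr.coe_nonneg
  -- linear term
  have l1 : c * I ≤ L (∫ s in (0:ℝ)..τ, b (Φ' x s)) := by
    rw [← ContinuousLinearMap.intervalIntegral_comp_comm L (hbw.intervalIntegrable _ _), hI,
      ← intervalIntegral.integral_const_mul]
    refine intervalIntegral.integral_mono_on hτ.1 ((continuous_const.mul hχw).intervalIntegrable _ _)
      ((L.continuous.comp hbw).intervalIntegrable _ _) fun s _ => d.bL _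
  have l2 : |L (Φ' x τ - Φ x τ - ∫ s in (0:ℝ)..τ, b (Φ' x s))| ≤ c / 4 * I := by
    rw [← Real.norm_eq_abs]
    refine (L.le_opNorm _).trans ((mul_le_mul_of_nonneg_left p1 (norm_nonneg _)).trans ?_)
    have : ‖L‖ * D * (Real.exp (K * τ) - 1) ≤ c / 4 := by
      refine le_trans ?_ hδ2
      have := d.hD
      gcongr
    nlinarith
  have l3 := hV _ hzR
  have l4 := hV _ hwR
  rw [map_sub, map_sub] at l2
  have l5 : 3 / 4 * c * I - 2 * θ * R ≤ J γ r (Φ (Φ' x τ)) - J γ r (Φ (Φ x τ)) := by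
    have := abs_le.mp l2
    have := abs_le.mp l3
    have := abs_le.mp l4
    have := mul_le_mul_of_nonneg_left hzR hθ
    have := mul_le_mul_of_nonneg_left hwR hθ
    linarith
  have hR : 0 ≤ R := (norm_nonneg _).trans hzR
  have g1 : γ ^ τ ≤ 1 := Real.rpow_le_one d.h0.le d.h1.le hτ.1
  have g2 : 1 / 2 ≤ γ ^ τ := hδ4.trans (Real.rpow_le_rpow_of_exponent_ge d.h0 d.h1.le hτ.2)
  have l6 := mul_le_mul_of_nonneg_left l5 (by linarith : 0 ≤ γ ^ τ)
  have l7 : 3 / 8 * c * I - 2 * θ * R ≤ γ ^ τ * (3 / 4 * c * I - 2 * θ * R) := by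
    have a1 : 0 ≤ c * I := mul_nonneg d.hc.le hI0
    have a2 : 0 ≤ θ * R := mul_nonneg hθ hR
    nlinarith
  rw [J_flow d.h0 d.h1 d.hr d.hr01 d.fl d.hv x hτ.1, J_flow d.h0 d.h1 d.hr d.hr01 d.fl' d.hv' x hτ.1]
  have := abs_le.mp i1
  linarith

lemma Data.core (d : Data γ r v b Φ Φ' χ K K' D c ε L) {δ h ρ R θ η κ : ℝ} {Lr : NNReal}
    (hh : 0 < h) (hhδ : h ≤ δ)
    (hδ1 : Real.exp (K * δ) ≤ 2)
    (hδ2 : ‖L‖ * D * (Real.exp (K * δ) - 1) ≤ c / 4)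
    (hδ3 : δ * (Lr * (2 * D)) ≤ c / 8) (hδ4 : 1 / 2 ≤ γ ^ δ)
    (hrL : LipschitzOnWith Lr r (Metric.closedBall 0 ρ))
    (hz : ∀ x, ‖x‖ ≤ ε → ∀ t ∈ Icc (0:ℝ) h, ‖Φ x t‖ ≤ ρ)
    (hw : ∀ x, ‖x‖ ≤ ε → ∀ t ∈ Icc (0:ℝ) h, ‖Φ' x t‖ ≤ ρ)
    (hzR : ∀ x, ‖x‖ ≤ ε → ‖Φ x h‖ ≤ R) (hwR : ∀ x, ‖x‖ ≤ ε → ‖Φ' x h‖ ≤ R) (hθ : 0 ≤ θ)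
    (hV : ∀ p, ‖p‖ ≤ R → |J γ r (Φ p) - J γ r (Φ 0) - L p| ≤ θ * ‖p‖)
    (hη : 2 * θ * R ≤ c / 4 * (η * ε))
    (hbad : ∀ x, ‖x‖ ≤ ε → (∫ s in (0:ℝ)..h, χ (Φ' x s)) ≤ η * ε → ∃ y, ∃ g ∈ Icc (0:ℝ) (γ ^ δ),
      γ ^ h * (J γ r (Φ' (Φ' x h)) - J γ r (Φ (Φ' x h))) = g * (J γ r (Φ' y) - J γ r (Φ y)))
    (hκ : κ ≤ ∫ s in (0:ℝ)..h, χ (Φ' 0 s)) :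
    c / 4 * κ - 2 * θ * R - 2 * θ * R / (1 - γ ^ δ) ≤ J γ r (Φ' 0) - J γ r (Φ 0) := by
  have hstep := fun x (hx : ‖x‖ ≤ ε) => d.step x (τ := h) ⟨hh.le, hhδ⟩ hδ1 hδ2 hδ3 hδ4 hrL
    (hz x hx) (hw x hx) (hzR x hx) (hwR x hx) hθ hV
  have hc := d.hc
  have hε := d.hε
  have hR : 0 ≤ R := (norm_nonneg _).trans (hzR 0 (by simpa using hε.le))
  have hγh := Real.rpow_pos_of_pos d.h0 h
  have hγh1 : γ ^ h ≤ 1 := Real.rpow_le_one d.h0.le d.h1.le hh.le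
  have hI0 : ∀ x, 0 ≤ ∫ s in (0:ℝ)..h, χ (Φ' x s) := fun x =>
    intervalIntegral.integral_nonneg hh.le fun s _ => d.χ0 _
  refine renewal d.h0 d.h1 (Δ := fun x => J γ r (Φ' x) - J γ r (Φ x)) (ε := ε) hh
    (hh.trans_le hhδ) (by positivity) ?_ ?_ ?_ ?_
  · refine ⟨0 - ∫ t in Ioi (0:ℝ), γ ^ t, fun x => sub_le_sub (J_nonneg d.h0 d.hr01 _)
      (J_le d.h0 d.h1 d.hr d.hr01 (d.fl.sol x).cont)⟩
  · intro m hm hmΔ x hx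
    have hs := hstep x hx
    rcases le_total (∫ s in (0:ℝ)..h, χ (Φ' x s)) (η * ε) with hb | hg
    · refine (min_le_right _ _).trans ?_
      obtain ⟨y, g, hg, he⟩ := hbad x hx hb
      rw [he] at hs
      have h1 : γ ^ δ * m ≤ g * m := mul_le_mul_of_nonpos_right hg.2 hm
      have h2 : g * m ≤ g * (J γ r (Φ' y) - J γ r (Φ y)) :=
        mul_le_mul_of_nonneg_left (hmΔ y) hg.1
      have h3 : 0 ≤ c / 4 * (∫ s in (0:ℝ)..h, χ (Φ' x s)) := mul_nonneg (by positivity) (hI0 x)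
      linarith
    · refine (min_le_left _ _).trans ?_
      have h2 := mul_le_mul_of_nonneg_left (hmΔ (Φ' x h)) hγh.le
      have h3 : c / 4 * (η * ε) ≤ c / 4 * (∫ s in (0:ℝ)..h, χ (Φ' x s)) :=
        mul_le_mul_of_nonneg_left hg (by positivity)
      linarith
  · exact entry d.h0 d.h1 d.hr d.hr01 d.fl d.fl' d.hv d.hv' d.bz
  · intro m hm hmΔ
    have hs := hstep 0 (by simpa using hε.le)
    have h2 := mul_le_mul_of_nonneg_left (hmΔ (Φ' 0 h)) hγh.le
    have h3 : c / 4 * κ ≤ c / 4 * (∫ s in (0:ℝ)..h, χ (Φ' 0 s)) :=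
      mul_le_mul_of_nonneg_left hκ (by positivity)
    have h4 : m ≤ γ ^ h * m := by nlinarith
    linarith

lemma Data.fbound (d : Data γ r v b Φ Φ' χ K K' D c ε L) (p : X) :
    ‖v p + b p‖ ≤ (‖v 0‖ + D) + K * ‖p‖ := by
  have h1 := d.vbound p
  have h2 := d.bD p
  have h3 := d.χle p
  have h4 := norm_add_le (v p) (b p)
  have h5 := d.hD
  nlinarith

lemma Data.kappa (d : Data γ r v b Φ Φ' χ K K' D c ε L) {M h : ℝ} (hM : ‖v 0‖ + D + 2 ≤ M)
    (hh : ε / (2 * M) ≤ h) (hKε : K * (ε / 2) ≤ 1) :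
    ε / (2 * M) ≤ ∫ s in (0:ℝ)..h, χ (Φ' 0 s) := by
  have hD := d.hD
  have hε := d.hε
  have hM0 : 0 < M := by linarith [norm_nonneg (v 0)]
  have hχw : Continuous fun s => χ (Φ' 0 s) := d.χc.comp (d.fl'.sol 0).cont
  have hT : M * (ε / (2 * M)) = ε / 2 := by field_simp
  have hT0 : 0 ≤ ε / (2 * M) := by positivity
  have hs := stay (d.fbound) hM (by linarith [d.hK]) hM0.le (d.fl'.sol 0) (ρ := 0)
    (T := ε / (2 * M)) (by simp [d.fl'.init]) (by rw [hT, zero_add]; exact hKε)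
  calc ε / (2 * M) = ∫ s in (0:ℝ)..(ε / (2 * M)), (1:ℝ) := by simp
    _ = ∫ s in (0:ℝ)..(ε / (2 * M)), χ (Φ' 0 s) := by
        refine intervalIntegral.integral_congr fun s hs' => ?_
        rw [uIcc_of_le hT0] at hs'
        refine (d.χ1 _ ?_).symm
        have h1 := hs s hs'
        have h2 : M * s ≤ M * (ε / (2 * M)) := mul_le_mul_of_nonneg_left hs'.2 hM0.le
        linarith
    _ ≤ _ := intervalIntegral.integral_mono_interval le_rfl hT0 hh
            (Eventually.of_forall fun s => d.χ0 _) (hχw.intervalIntegrable _ _)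

lemma drift (hv : LipschitzWith K v) {z : ℝ → X} (hz : IsSol v z) {T ρ : ℝ}
    (hρ : ∀ t ∈ Icc (0:ℝ) T, ‖z t‖ ≤ ρ) :
    ∀ t ∈ Icc (0:ℝ) T, ‖z t - z 0 - t • v 0‖ ≤ K * ρ * t := by
  intro t ht
  have := norm_image_sub_le_of_norm_deriv_right_le_segment (f := fun t => z t - t • v 0)
    (f' := fun t => v (z t) - v 0) (C := K * ρ) (a := 0) (b := T)
    ((hz.cont.sub (continuous_id.smul continuous_const)).continuousOn)
    (fun s hs => by
      have h2 := ((hasDerivAt_id s).smul_const (v 0)).hasDerivWithinAt (s := Ici s)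
      rw [one_smul] at h2
      exact (hz.der s hs.1).sub h2)
    (fun s hs => by
      have h3 := hv.dist_le_mul (z s) 0
      rw [dist_eq_norm, dist_zero_right] at h3
      exact h3.trans (mul_le_mul_of_nonneg_left (hρ s ⟨hs.1, hs.2.le⟩) K.coe_nonneg)) t ht
  simp only [zero_smul, sub_zero] at this
  rwa [show z t - z 0 - t • v 0 = z t - t • v 0 - z 0 by abel]

lemma Data.bad (d : Data γ r v b Φ Φ' χ K K' D c ε L) {M ρ δ h : ℝ} (hM : ‖v 0‖ + D + 2 ≤ M)
    (hv0 : 0 < ‖v 0‖) (hρ1 : K * ρ ≤ ‖v 0‖ / 2) (hρ2 : K * ρ ≤ 1) (hh : h = 8 / ‖v 0‖ * ε)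
    (hhδ : h ≤ δ) (hsum : ε + M * h + M * δ ≤ ρ) (hδ1 : Real.exp (K * δ) ≤ 2)
    (x : X) (hx : ‖x‖ ≤ ε) (hI : (∫ s in (0:ℝ)..h, χ (Φ' x s)) ≤ 1 / (2 * D) * ε) :
    ∃ y, ∃ g ∈ Icc (0:ℝ) (γ ^ δ),
      γ ^ h * (J γ r (Φ' (Φ' x h)) - J γ r (Φ (Φ' x h))) = g * (J γ r (Φ' y) - J γ r (Φ y)) := by
  have hD := d.hD
  have hε := d.hε
  have hK : (0:ℝ) ≤ K := K.coe_nonneg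
  have hM0 : 0 < M := by linarith
  have hh0 : 0 < h := by rw [hh]; positivity
  have hδ0 : 0 < δ := by linarith
  have hMh : 0 < M * h := by positivity
  have hMδ : 0 < M * δ := by positivity
  obtain ⟨l, hl1, hl2⟩ := exists_dual_vector'' ℝ (v 0)
  have hl : ∀ p, |l p| ≤ ‖p‖ := fun p => by
    rw [← Real.norm_eq_abs]
    exact (l.le_opNorm p).trans (mul_le_of_le_one_left (norm_nonneg _) hl1)
  have hl2' : l (v 0) = ‖v 0‖ := hl2
  -- growth of l along v-trajectories in the ball
  have grow : ∀ p T, (∀ t ∈ Icc (0:ℝ) T, ‖Φ p t‖ ≤ ρ) → ∀ t ∈ Icc (0:ℝ) T,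
      l p + t * (‖v 0‖ / 2) ≤ l (Φ p t) := by
    intro p T hp t ht
    have h1 := drift d.hv (d.fl.sol p) hp t ht
    have h2 := (abs_le.mp ((hl _).trans h1)).1
    rw [map_sub, map_sub, map_smul, smul_eq_mul, hl2', d.fl.init] at h2
    have h3 := mul_le_mul_of_nonneg_right hρ1 ht.1
    linarith
  have vb := fun p => d.vbound p
  -- first stretch
  have z1 := stay vb (M := M) (by linarith) hK hM0.le (d.fl.sol x) (ρ := ε) (T := h)
    (by rw [d.fl.init]; exact hx) (by
      refine (mul_le_mul_of_nonneg_left ?_ hK).trans hρ2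
      linarith)
  have w1 := stay d.fbound hM hK hM0.le (d.fl'.sol x) (ρ := ε) (T := h)
    (by rw [d.fl'.init]; exact hx) (by
      refine (mul_le_mul_of_nonneg_left ?_ hK).trans hρ2
      linarith)
  have lz := grow x h (fun t ht => (z1 t ht).trans (by
    have := mul_le_mul_of_nonneg_left ht.2 hM0.le
    linarith)) h ⟨hh0.le, le_rfl⟩
  have hh2 : h * (‖v 0‖ / 2) = 4 * ε := by rw [hh]; field_simp; norm_num
  have lx := (abs_le.mp ((hl x).trans hx)).1
  have hexp : Real.exp (K * h) ≤ 2 := le_trans (by gcongr) hδ1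
  have dd := d.dist_le x hexp (t := h) ⟨hh0.le, le_rfl⟩
  have dd2 : ‖Φ' x h - Φ x h‖ ≤ ε := by
    refine dd.trans ((mul_le_mul_of_nonneg_left hI (by positivity)).trans (le_of_eq ?_))
    field_simp
  have ly := (abs_le.mp ((hl _).trans dd2)).1
  rw [map_sub] at ly
  set y := Φ' x h with hy
  have ly2 : 2 * ε ≤ l y := by linarith
  have hyn : ‖y‖ ≤ ε + M * h := w1 h ⟨hh0.le, le_rfl⟩
  -- second stretch
  have z2 := stay vb (M := M) (by linarith) hK hM0.le (d.fl.sol y) (ρ := ε + M * h) (T := δ)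
    (by rw [d.fl.init]; exact hyn) ((mul_le_mul_of_nonneg_left hsum hK).trans hρ2)
  have l2 := grow y δ (fun t ht => (z2 t ht).trans (by
    have := mul_le_mul_of_nonneg_left ht.2 hM0.le
    linarith))
  have ag : ∀ t ∈ Icc (0:ℝ) δ, Φ y t = Φ' y t := by
    refine agree' d.hv' (d.fl.sol y) (d.fl'.sol y) (by rw [d.fl.init, d.fl'.init]) fun t ht => ?_
    refine d.bz _ ?_
    have h1 := l2 t ⟨ht.1, ht.2.le⟩
    have h2 := (abs_le.mp (hl (Φ y t))).2
    have h3 : 0 ≤ t * (‖v 0‖ / 2) := mul_nonneg ht.1 (by positivity)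
    linarith
  have hg : 0 < γ ^ h := Real.rpow_pos_of_pos d.h0 h
  have hg' : 0 < γ ^ δ := Real.rpow_pos_of_pos d.h0 δ
  have hg1 : γ ^ h ≤ 1 := Real.rpow_le_one d.h0.le d.h1.le hh0.le
  refine ⟨Φ' y δ, γ ^ h * γ ^ δ, ⟨by positivity, mul_le_of_le_one_left hg'.le hg1⟩, ?_⟩
  rw [diff_agree d.h0 d.h1 d.hr d.hr01 d.fl d.fl' d.hv d.hv' y hδ0.le ag]
  ring

lemma small {f : ℝ → ℝ} (hf : Continuous f) {a : ℝ} (h : f 0 < a) :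
    ∀ᶠ t in 𝓝[>] (0:ℝ), f t < a :=
  ((hf.tendsto 0).eventually_lt_const h).filter_mono nhdsWithin_le_nhds

lemma exists_δ (h0 : 0 < γ) (hc : 0 < c) (K : NNReal) (D M B l : ℝ) {ρ : ℝ} (hρ : 0 < ρ) :
    ∃ δ > 0, Real.exp ((K + 1) * δ) ≤ 2 ∧ Real.exp (K * δ) ≤ 2 ∧
      l * D * (Real.exp (K * δ) - 1) ≤ c / 4 ∧ δ * (B * (2 * D)) ≤ c / 8 ∧ 1 / 2 ≤ γ ^ δ ∧
      M * δ ≤ ρ / 2 := by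
  have e1 := small (f := fun δ => Real.exp ((K + 1) * δ)) (by fun_prop) (a := 2) (by simp)
  have e2 := small (f := fun δ => Real.exp (K * δ)) (by fun_prop) (a := 2) (by simp)
  have e3 := small (f := fun δ => l * D * (Real.exp (K * δ) - 1)) (by fun_prop) (a := c / 4)
    (by simpa using hc)
  have e4 := small (f := fun δ => δ * (B * (2 * D))) (by fun_prop) (a := c / 8)
    (by simpa using hc)
  have e5 := small (f := fun δ : ℝ => - γ ^ δ) (cont_rpow h0).neg (a := -(1 / 2))
    (by norm_num)
  have e6 := small (f := fun δ => M * δ) (by fun_prop) (a := ρ / 2) (by simpa using hρ)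
  have e7 : ∀ᶠ t in 𝓝[>] (0:ℝ), 0 < t := self_mem_nhdsWithin
  obtain ⟨δ, p1, p2, p3, p4, p5, p6, p7⟩ :=
    (e1.and (e2.and (e3.and (e4.and (e5.and (e6.and e7)))))).exists
  exact ⟨δ, p7, p1.le, p2.le, p3.le, p4.le, by linarith, p6.le⟩

theorem improve (h0 : 0 < γ) (h1 : γ < 1) (hv0 : LipschitzWith K v) (hK1 : 1 ≤ (K:ℝ))
    {Lr : NNReal} {ρr : ℝ} (hρr : 0 < ρr) (hrL : LipschitzOnWith Lr r (Metric.closedBall 0 ρr))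
    (hV : HasFDerivAt (fun p => J γ r (Φ p)) L 0) (hD : 0 < D) (hc : 0 < c) :
    ∃ ε₀ > 0, ∀ ε, 0 < ε → ε < ε₀ → ∀ b Φ' χ K', Data γ r v b Φ Φ' χ K K' D c ε L →
      J γ r (Φ 0) < J γ r (Φ' 0) := by
  have hKp : (0:ℝ) < K := by linarith
  set M := ‖v 0‖ + D + 2 with hM
  have hMn : ‖v 0‖ ≤ M := by linarith
  have hM0 : 0 < M := by linarith [norm_nonneg (v 0)]
  -- the choice of θ
  have chooseθ : ∀ K1 q : ℝ, ∃ θ > 0, 2 * θ * K1 < c / 4 * (1 / (2 * D)) ∧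
      2 * θ * K1 + 2 * θ * K1 / q < c / 4 * (1 / (2 * M)) := by
    intro K1 q
    have e1 := small (f := fun θ => 2 * θ * K1) (by fun_prop) (a := c / 4 * (1 / (2 * D)))
      (by simp only [mul_zero, zero_mul]; positivity)
    have e2 := small (f := fun θ => 2 * θ * K1 + 2 * θ * K1 / q) (by fun_prop)
      (a := c / 4 * (1 / (2 * M)))
      (by simp only [mul_zero, zero_mul, zero_div, add_zero]; positivity)
    have e7 : ∀ᶠ t in 𝓝[>] (0:ℝ), 0 < t := self_mem_nhdsWithin
    obtain ⟨θ, p1, p2, p3⟩ := (e1.and (e2.and e7)).exists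
    exact ⟨θ, p3, p1, p2⟩
  have chooseρ : ∀ θ > 0, ∃ ρ' > 0, ∀ p : X, ‖p‖ < ρ' →
      |J γ r (Φ p) - J γ r (Φ 0) - L p| ≤ θ * ‖p‖ := by
    intro θ hθ
    have := hV.isLittleO.def hθ
    obtain ⟨ρ', hρ', hp⟩ := Metric.eventually_nhds_iff.mp this
    refine ⟨ρ', hρ', fun p hpn => ?_⟩
    have := hp (y := p) (by simpa using hpn)
    simpa using this
  have final : ∀ K1 q θ ε : ℝ, 0 < ε → 2 * θ * K1 + 2 * θ * K1 / q < c / 4 * (1 / (2 * M)) →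
      0 < c / 4 * (ε / (2 * M)) - 2 * θ * (K1 * ε) - 2 * θ * (K1 * ε) / q := by
    intro K1 q θ ε hε h
    have e : c / 4 * (ε / (2 * M)) - 2 * θ * (K1 * ε) - 2 * θ * (K1 * ε) / q =
      ε * (c / 4 * (1 / (2 * M)) - (2 * θ * K1 + 2 * θ * K1 / q)) := by ring
    rw [e]
    exact mul_pos hε (by linarith)
  by_cases hv00 : v 0 = 0
  · obtain ⟨δ, hδ, q1, q2, q3, q4, q5, -⟩ := exists_δ h0 hc K D M Lr ‖L‖ hρr
    obtain ⟨θ, hθ, t1, t2⟩ := chooseθ 2 (1 - γ ^ δ)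
    obtain ⟨ρ', hρ', hp⟩ := chooseρ θ hθ
    have e1 := small (f := fun ε => 2 * ε) (by fun_prop) (a := ρ') (by simpa using hρ')
    have e2 := small (f := fun ε => 2 * ε) (by fun_prop) (a := ρr) (by simpa using hρr)
    have e3 := small (f := fun ε => ε / (2 * M)) (by fun_prop) (a := δ) (by simpa using hδ)
    have e4 := small (f := fun ε => K * (ε / 2)) (by fun_prop) (a := 1) (by simp)
    obtain ⟨ε₀, hε₀, H⟩ := (mem_nhdsGT_iff_exists_Ioo_subset).mp (e1.and (e2.and (e3.and e4)))
    refine ⟨ε₀, hε₀, fun ε hε hlt b Φ' χ K' d => ?_⟩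
    obtain ⟨p1, p2, p3, p4⟩ := H ⟨hε, hlt⟩
    have sz : ∀ x, ‖x‖ ≤ ε → ∀ t ∈ Icc (0:ℝ) δ, ‖Φ x t‖ ≤ 2 * ε := fun x hx =>
      stay0 hKp.le hε (fun p _ => by simpa [hv00] using d.vbound p) (d.fl.sol x)
        (by rw [d.fl.init]; exact hx) q1
    have sw : ∀ x, ‖x‖ ≤ ε → ∀ t ∈ Icc (0:ℝ) δ, ‖Φ' x t‖ ≤ 2 * ε := fun x hx =>
      stay0 hKp.le hε (fun p hp => by simpa [hv00, d.bz p hp] using d.vbound p) (d.fl'.sol x)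
        (by rw [d.fl'.init]; exact hx) q1
    have := d.core (δ := δ) (h := δ) (ρ := ρr) (R := 2 * ε) (θ := θ) (η := 1 / (2 * D))
      (κ := ε / (2 * M)) hδ le_rfl q2 q3 q4 q5 hrL
      (fun x hx t ht => (sz x hx t ht).trans p2.le) (fun x hx t ht => (sw x hx t ht).trans p2.le)
      (fun x hx => sz x hx δ ⟨hδ.le, le_rfl⟩) (fun x hx => sw x hx δ ⟨hδ.le, le_rfl⟩) hθ.le
      (fun p hpn => hp p (hpn.trans_lt p1)) (by nlinarith)
      (fun x hx _ => ⟨_, γ ^ δ, ⟨(Real.rpow_pos_of_pos h0 δ).le, le_rfl⟩, rfl⟩)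
      (d.kappa hM.ge p3.le p4.le)
    have := final 2 (1 - γ ^ δ) θ ε hε t2
    linarith
  · have hn : 0 < ‖v 0‖ := norm_pos_iff.mpr hv00
    obtain ⟨ρ, hρ, hρ1, hρ2, hρ3⟩ : ∃ ρ > 0, ρ ≤ ρr ∧ K * ρ ≤ ‖v 0‖ / 2 ∧ K * ρ ≤ 1 := by
      have e1 := small (f := fun ρ => ρ) (by fun_prop) (a := ρr) hρr
      have e2 := small (f := fun ρ => K * ρ) (by fun_prop) (a := ‖v 0‖ / 2) (by simpa using hv00)
      have e3 := small (f := fun ρ => K * ρ) (by fun_prop) (a := 1) (by simp)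
      have e7 : ∀ᶠ t in 𝓝[>] (0:ℝ), 0 < t := self_mem_nhdsWithin
      obtain ⟨ρ, p1, p2, p3, p4⟩ := (e1.and (e2.and (e3.and e7))).exists
      exact ⟨ρ, p4, p1.le, p2.le, p3.le⟩
    obtain ⟨δ, hδ, -, q2, q3, q4, q5, q6⟩ := exists_δ h0 hc K D M Lr ‖L‖ hρ
    set K0 := 8 / ‖v 0‖ with hK0
    have hK0p : 0 < K0 := by positivity
    set K1 := 1 + M * K0 with hK1d
    obtain ⟨θ, hθ, t1, t2⟩ := chooseθ K1 (1 - γ ^ δ)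
    obtain ⟨ρ', hρ', hp⟩ := chooseρ θ hθ
    have e1 := small (f := fun ε => K1 * ε) (by fun_prop) (a := ρ') (by simpa using hρ')
    have e2 := small (f := fun ε => K1 * ε) (by fun_prop) (a := ρ / 2) (by simpa using hρ)
    have e3 := small (f := fun ε => K0 * ε) (by fun_prop) (a := δ) (by simpa using hδ)
    have e4 := small (f := fun ε => K * (ε / 2)) (by fun_prop) (a := 1) (by simp)
    obtain ⟨ε₀, hε₀, H⟩ := (mem_nhdsGT_iff_exists_Ioo_subset).mp (e1.and (e2.and (e3.and e4)))
    refine ⟨ε₀, hε₀, fun ε hε hlt b Φ' χ K' d => ?_⟩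
    obtain ⟨p1, p2, p3, p4⟩ := H ⟨hε, hlt⟩
    have hR : K1 * ε = ε + M * (K0 * ε) := by rw [hK1d]; ring
    have hh0 : 0 < K0 * ε := by positivity
    have hb1 : ∀ t ∈ Icc (0:ℝ) (K0 * ε), ε + M * t ≤ K1 * ε := fun t ht => by
      have := mul_le_mul_of_nonneg_left ht.2 hM0.le
      linarith
    have hb2 : K * (ε + M * (K0 * ε)) ≤ 1 := by
      rw [← hR]
      exact (mul_le_mul_of_nonneg_left (by linarith) hKp.le).trans hρ3
    have sz : ∀ x, ‖x‖ ≤ ε → ∀ t ∈ Icc (0:ℝ) (K0 * ε), ‖Φ x t‖ ≤ K1 * ε := fun x hx t ht =>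
      (stay (fun p => d.vbound p) (M := M) (by linarith) hKp.le hM0.le (d.fl.sol x)
        (by rw [d.fl.init]; exact hx) hb2 t ht).trans (hb1 t ht)
    have sw : ∀ x, ‖x‖ ≤ ε → ∀ t ∈ Icc (0:ℝ) (K0 * ε), ‖Φ' x t‖ ≤ K1 * ε := fun x hx t ht =>
      (stay d.fbound (M := M) (by linarith) hKp.le hM0.le (d.fl'.sol x)
        (by rw [d.fl'.init]; exact hx) hb2 t ht).trans (hb1 t ht)
    have hk : ε / (2 * M) ≤ K0 * ε := by
      have : 1 / (2 * M) ≤ K0 := by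
        rw [hK0]
        rw [div_le_div_iff₀ (by positivity) hn]
        linarith
      calc ε / (2 * M) = 1 / (2 * M) * ε := by ring
        _ ≤ _ := by gcongr
    have := d.core (δ := δ) (h := K0 * ε) (ρ := ρ) (R := K1 * ε) (θ := θ) (η := 1 / (2 * D))
      (κ := ε / (2 * M)) hh0 p3.le q2 q3 q4 q5
      (hrL.mono (Metric.closedBall_subset_closedBall hρ1))
      (fun x hx t ht => (sz x hx t ht).trans (by linarith))
      (fun x hx t ht => (sw x hx t ht).trans (by linarith))
      (fun x hx => sz x hx _ ⟨hh0.le, le_rfl⟩) (fun x hx => sw x hx _ ⟨hh0.le, le_rfl⟩) hθ.le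
      (fun p hpn => hp p (hpn.trans_lt p1)) (by nlinarith)
      (fun x hx hI => d.bad hM.ge hn hρ2 hρ3 rfl p3.le (by linarith) q2 x hx hI)
      (d.kappa hM.ge hk p4.le)
    have := final K1 (1 - γ ^ δ) θ ε hε t2
    linarith

section fin
variable {S A : Type*} [NormedAddCommGroup S] [NormedSpace ℝ S]
  [NormedAddCommGroup A] [NormedSpace ℝ A]

lemma mkSol {F : S → A → S} {G : S → A → A} {x : ℝ → S} {y : ℝ → A}
    (h : ∀ t : ℝ, 0 ≤ t → HasDerivAt x (F (x t) (y t)) t ∧ HasDerivAt y (G (x t) (y t)) t) :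
    IsSol (fun p : S × A => (F p.1 p.2, G p.1 p.2)) (fun t => (x (max t 0), y (max t 0))) := by
  constructor
  · rw [continuous_iff_continuousAt]
    intro t
    have hm : ContinuousAt (fun t : ℝ => max t 0) t := by fun_prop
    have h1 := h (max t 0) (le_max_right _ _)
    exact (ContinuousAt.comp (f := fun t : ℝ => max t 0) h1.1.continuousAt hm).prodMk
      (ContinuousAt.comp (f := fun t : ℝ => max t 0) h1.2.continuousAt hm)
  · intro t ht
    have h1 := h t ht
    have h2 := (h1.1.hasDerivWithinAt (s := Ici t)).prodMk (h1.2.hasDerivWithinAt (s := Ici t))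
    simp only [max_eq_left ht]
    refine h2.congr (fun s hs => ?_) (by simp [max_eq_left ht])
    have : 0 ≤ s := ht.trans hs
    simp [max_eq_left this]

end fin

lemma align {A : Type*} [NormedAddCommGroup A] [InnerProductSpace ℝ A] {g w : A} {C : ℝ}
    (hC : 0 < C) (hg : g ≠ 0) (hw : ‖w‖ ≤ C) (h : ¬ ∃ α : ℝ, 0 < α ∧ w = α • g) :
    0 < inner ℝ g ((C / ‖g‖) • g - w) := by
  have hg' : 0 < ‖g‖ := norm_pos_iff.2 hg
  by_contra hcon
  push Not at hcon
  apply h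
  refine ⟨C / ‖g‖, by positivity, ?_⟩
  rw [inner_sub_right, inner_smul_right, real_inner_self_eq_norm_sq] at hcon
  have e1 : C / ‖g‖ * ‖g‖ ^ 2 = C * ‖g‖ := by field_simp
  rw [e1] at hcon
  have e2 := norm_sub_sq_real w ((C / ‖g‖) • g)
  rw [inner_smul_right, norm_smul, real_inner_comm] at e2
  have e3 : ‖C / ‖g‖‖ * ‖g‖ = C := by
    rw [Real.norm_of_nonneg (by positivity)]; field_simp
  rw [e3] at e2
  have e4 : C ^ 2 ≤ C / ‖g‖ * inner ℝ g w := by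
    have : C / ‖g‖ * (C * ‖g‖) ≤ C / ‖g‖ * inner ℝ g w := by
      apply mul_le_mul_of_nonneg_left _ (by positivity); linarith
    have e5 : C / ‖g‖ * (C * ‖g‖) = C ^ 2 := by field_simp
    linarith
  have e6 : ‖w‖ ^ 2 ≤ C ^ 2 := by gcongr
  have e7 : ‖w - (C / ‖g‖) • g‖ ^ 2 ≤ 0 := by linarith
  have e8 : ‖w - (C / ‖g‖) • g‖ = 0 := by
    have := le_antisymm e7 (sq_nonneg _)
    exact pow_eq_zero_iff (two_ne_zero) |>.1 this
  exact sub_eq_zero.1 (norm_eq_zero.1 e8)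

end QSMaux
/-- strict improvement step: if `Ψ` is a smooth `C`-bounded Lipschitz
vector field, `Q^Ψ` is differentiable at the origin, `∇ₐQ^Ψ(𝟎,𝟎) ≠ 0`, and `Ψ(𝟎,𝟎)` is
not a positive scalar multiple of `∇ₐQ^Ψ(𝟎,𝟎)`, then there is a smooth `C`-bounded
Lipschitz vector field `Ψ'` with `Q^{Ψ'}(𝟎,𝟎) > Q^Ψ(𝟎,𝟎)`. -/
theorem qsm_stmt6 {ns na : ℕ} (γ C : ℝ) (hγ : γ ∈ Set.Ioo (0:ℝ) 1) (hC : 0 < C)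
    (F : EuclideanSpace ℝ (Fin ns) → EuclideanSpace ℝ (Fin na) → EuclideanSpace ℝ (Fin ns))
    (hF : ∃ K : NNReal, LipschitzWith K
      (fun p : EuclideanSpace ℝ (Fin ns) × EuclideanSpace ℝ (Fin na) => F p.1 p.2))
    (r : EuclideanSpace ℝ (Fin ns) → ℝ)
    (hrsmooth : ContDiff ℝ (⊤ : ℕ∞) r) (hr01 : ∀ x, r x ∈ Set.Icc (0:ℝ) 1)
    -- the solution map of the joint dynamics, for each admissible vector field
    (st : (EuclideanSpace ℝ (Fin ns) → EuclideanSpace ℝ (Fin na) →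
        EuclideanSpace ℝ (Fin na)) →
      EuclideanSpace ℝ (Fin ns) → EuclideanSpace ℝ (Fin na) → ℝ →
      EuclideanSpace ℝ (Fin ns))
    (ac : (EuclideanSpace ℝ (Fin ns) → EuclideanSpace ℝ (Fin na) →
        EuclideanSpace ℝ (Fin na)) →
      EuclideanSpace ℝ (Fin ns) → EuclideanSpace ℝ (Fin na) → ℝ →
      EuclideanSpace ℝ (Fin na))
    (hinit : ∀ Ψ, QSM.Admissible C Ψ → ∀ s₀ a₀,
      st Ψ s₀ a₀ 0 = s₀ ∧ ac Ψ s₀ a₀ 0 = a₀)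
    (hODE : ∀ Ψ, QSM.Admissible C Ψ → ∀ s₀ a₀, ∀ t : ℝ, 0 ≤ t →
      HasDerivAt (st Ψ s₀ a₀) (F (st Ψ s₀ a₀ t) (ac Ψ s₀ a₀ t)) t ∧
      HasDerivAt (ac Ψ s₀ a₀) (Ψ (st Ψ s₀ a₀ t) (ac Ψ s₀ a₀ t)) t)
    -- the Q-function of each admissible vector field
    (Q : (EuclideanSpace ℝ (Fin ns) → EuclideanSpace ℝ (Fin na) →
        EuclideanSpace ℝ (Fin na)) →
      EuclideanSpace ℝ (Fin ns) → EuclideanSpace ℝ (Fin na) → ℝ)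
    (hQ : ∀ Ψ s₀ a₀, Q Ψ s₀ a₀ = ∫ t in Set.Ioi (0:ℝ), γ ^ t * r (st Ψ s₀ a₀ t))
    -- a smooth `C`-bounded Lipschitz vector field `Ψ`
    (Ψ : EuclideanSpace ℝ (Fin ns) → EuclideanSpace ℝ (Fin na) →
      EuclideanSpace ℝ (Fin na))
    (hΨ : QSM.Admissible C Ψ)
    -- Q^Ψ is differentiable at the origin
    (hdiff : DifferentiableAt ℝ
      (fun p : EuclideanSpace ℝ (Fin ns) × EuclideanSpace ℝ (Fin na) => Q Ψ p.1 p.2)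
      (0, 0))
    -- the action gradient at the origin is nonzero
    (hgrad : gradient (fun a' => Q Ψ 0 a') 0 ≠ 0)
    -- and Ψ(𝟎,𝟎) is not a positive scalar multiple of it
    (hnotalign : ¬ ∃ α : ℝ, 0 < α ∧
      Ψ 0 0 = α • gradient (fun a' => Q Ψ 0 a') 0) :
    ∃ Ψ' : EuclideanSpace ℝ (Fin ns) → EuclideanSpace ℝ (Fin na) →
        EuclideanSpace ℝ (Fin na),
      QSM.Admissible C Ψ' ∧ Q Ψ 0 0 < Q Ψ' 0 0 := by
  classical
  obtain ⟨h0, h1⟩ := hγ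
  obtain ⟨KF, hKF⟩ := hF
  have hΨ0 := hΨ
  obtain ⟨hΨs, ⟨KΨ, hKΨ⟩, hΨC⟩ := hΨ0
  set g := gradient (fun a' => Q Ψ 0 a') 0 with hgdef
  set flow : (EuclideanSpace ℝ (Fin ns) → EuclideanSpace ℝ (Fin na) →
        EuclideanSpace ℝ (Fin na)) → EuclideanSpace ℝ (Fin ns) × EuclideanSpace ℝ (Fin na) →
        ℝ → EuclideanSpace ℝ (Fin ns) × EuclideanSpace ℝ (Fin na) :=
    fun G p t => (st G p.1 p.2 (max t 0), ac G p.1 p.2 (max t 0)) with hflow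
  have hfl : ∀ G, QSM.Admissible C G → QSMaux.IsFlow
      (fun p : EuclideanSpace ℝ (Fin ns) × EuclideanSpace ℝ (Fin na) =>
        (F p.1 p.2, G p.1 p.2)) (flow G) := by
    intro G hG
    refine ⟨fun p => QSMaux.mkSol (hODE G hG p.1 p.2), fun p => ?_⟩
    have := hinit G hG p.1 p.2
    simp [hflow, this.1, this.2]
  set r' : EuclideanSpace ℝ (Fin ns) × EuclideanSpace ℝ (Fin na) → ℝ := fun p => r p.1 with hr'
  have hQJ : ∀ G s a, Q G s a = QSMaux.J γ r' (flow G (s, a)) := by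
    intro G s a
    rw [hQ, QSMaux.J]
    refine setIntegral_congr_fun measurableSet_Ioi (fun t ht => ?_)
    have : max t 0 = t := max_eq_left (le_of_lt ht)
    simp [hr', hflow, this]
  have hr's : ContDiff ℝ (⊤ : ℕ∞) r' := hrsmooth.comp contDiff_fst
  obtain ⟨Lr, T, hT, hLr⟩ : ∃ K, ∃ t ∈ nhds
      (0 : EuclideanSpace ℝ (Fin ns) × EuclideanSpace ℝ (Fin na)), LipschitzOnWith K r' t :=
    (hr's.contDiffAt.of_le (by exact_mod_cast le_top)).exists_lipschitzOnWith
  obtain ⟨ρr, hρr, hρT⟩ := Metric.nhds_basis_closedBall.mem_iff.1 hT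
  -- derivative
  set L := fderiv ℝ (fun p : EuclideanSpace ℝ (Fin ns) × EuclideanSpace ℝ (Fin na) =>
    Q Ψ p.1 p.2) (0, 0) with hLdef
  have hL : HasFDerivAt (fun p : EuclideanSpace ℝ (Fin ns) × EuclideanSpace ℝ (Fin na) =>
    Q Ψ p.1 p.2) L (0, 0) := hdiff.hasFDerivAt
  have hLg : ∀ w, L (0, w) = inner ℝ g w := by
    intro w
    have k1 : HasFDerivAt (fun a' : EuclideanSpace ℝ (Fin na) => Q Ψ 0 a')
        (L.comp (ContinuousLinearMap.inr ℝ _ _)) 0 :=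
      HasFDerivAt.comp (f := fun a' : EuclideanSpace ℝ (Fin na) =>
        ((0 : EuclideanSpace ℝ (Fin ns)), a')) 0 hL (hasFDerivAt_prodMk_right 0 0)
    have k2 := k1.differentiableAt.hasGradientAt.hasFDerivAt
    have k3 := k1.unique k2
    have k4 := congrArg (fun f => f w) k3
    simpa only [ContinuousLinearMap.comp_apply, ContinuousLinearMap.inr_apply,
      InnerProductSpace.toDual_apply_apply] using k4
  have hV : HasFDerivAt (fun p => QSMaux.J γ r' (flow Ψ p)) L 0 := by
    have : (fun p => QSMaux.J γ r' (flow Ψ p)) = fun p => Q Ψ p.1 p.2 := by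
      funext p; rw [hQJ]
    rw [this]; exact hL
  set v : EuclideanSpace ℝ (Fin ns) × EuclideanSpace ℝ (Fin na) →
    EuclideanSpace ℝ (Fin ns) × EuclideanSpace ℝ (Fin na) :=
    fun p => (F p.1 p.2, Ψ p.1 p.2) with hv
  set K : NNReal := max (max KF KΨ) 1 with hKdef
  have hvK : LipschitzWith K v := (hKF.prodMk hKΨ).weaken (le_max_left _ _)
  have hK1 : 1 ≤ (K : ℝ) := by
    have : (1 : NNReal) ≤ K := le_max_right _ _
    exact_mod_cast this
  set u := (C / ‖g‖) • g with hu
  have hgpos : 0 < ‖g‖ := norm_pos_iff.2 hgrad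
  have hun : ‖u‖ = C := by
    rw [hu, norm_smul, Real.norm_of_nonneg (by positivity)]; field_simp
  have hpos : 0 < inner ℝ g (u - Ψ 0 0) := QSMaux.align hC hgrad (hΨC 0 0) hnotalign
  set c := inner ℝ g (u - Ψ 0 0) / 2 with hcdef
  have hc : 0 < c := by positivity
  obtain ⟨ε₀, hε₀, himp⟩ := QSMaux.improve h0 h1 hvK hK1 hρr (hLr.mono hρT) hV
    (show 0 < 2 * C by positivity) hc
  have hcont : Continuous (fun p : EuclideanSpace ℝ (Fin ns) × EuclideanSpace ℝ (Fin na) =>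
      inner ℝ g (u - Ψ p.1 p.2)) := by
    have := hKΨ.continuous
    exact continuous_const.inner (continuous_const.sub this)
  have hev : ∀ᶠ p in nhds (0 : EuclideanSpace ℝ (Fin ns) × EuclideanSpace ℝ (Fin na)),
      c < inner ℝ g (u - Ψ p.1 p.2) := by
    apply hcont.continuousAt.eventually_const_lt
    show c < inner ℝ g (u - Ψ 0 0)
    linarith
  obtain ⟨ρ0, hρ0, hρ⟩ := Metric.eventually_nhds_iff.1 hev
  set ε := min ε₀ ρ0 / 2 with hε
  have hmin : 0 < min ε₀ ρ0 := lt_min hε₀ hρ0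
  have hεpos : 0 < ε := by positivity
  have hε1 : ε < ε₀ := by have := min_le_left ε₀ ρ0; linarith
  have hε2 : ε < ρ0 := by have := min_le_right ε₀ ρ0; linarith
  let χ : ContDiffBump (0 : EuclideanSpace ℝ (Fin ns) × EuclideanSpace ℝ (Fin na)) :=
    ⟨ε / 2, ε, by positivity, by linarith⟩
  have hχs : ContDiff ℝ (⊤ : ℕ∞) χ := χ.contDiff
  set d : EuclideanSpace ℝ (Fin ns) × EuclideanSpace ℝ (Fin na) → EuclideanSpace ℝ (Fin na) :=
    fun p => χ p • (u - Ψ p.1 p.2) with hd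
  have hds : ContDiff ℝ (⊤ : ℕ∞) d := hχs.smul (contDiff_const.sub hΨs)
  have hdc : HasCompactSupport d := χ.hasCompactSupport.smul_right
  obtain ⟨Kd, hKd⟩ := ContDiff.lipschitzWith_of_hasCompactSupport hdc hds (by simp)
  set Ψ' : EuclideanSpace ℝ (Fin ns) → EuclideanSpace ℝ (Fin na) →
    EuclideanSpace ℝ (Fin na) := fun s a => Ψ s a + d (s, a) with hΨ'
  have hLip : LipschitzWith (KΨ + Kd)
      (fun p : EuclideanSpace ℝ (Fin ns) × EuclideanSpace ℝ (Fin na) => Ψ' p.1 p.2) :=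
    hKΨ.add hKd
  have hadm : QSM.Admissible C Ψ' := by
    refine ⟨hΨs.add hds, ⟨_, hLip⟩, fun s a => ?_⟩
    have e : Ψ' s a = (1 - χ (s, a)) • Ψ s a + χ (s, a) • u := by
      simp only [hΨ', hd]; module
    have x0 : 0 ≤ χ (s, a) := χ.nonneg
    have x1 : χ (s, a) ≤ 1 := χ.le_one
    calc ‖Ψ' s a‖ ≤ ‖(1 - χ (s, a)) • Ψ s a‖ + ‖χ (s, a) • u‖ := by
          rw [e]; exact norm_add_le _ _
      _ = (1 - χ (s, a)) * ‖Ψ s a‖ + χ (s, a) * C := by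
          rw [norm_smul, norm_smul, hun, Real.norm_of_nonneg x0,
            Real.norm_of_nonneg (by linarith)]
      _ ≤ (1 - χ (s, a)) * C + χ (s, a) * C := by
          have := mul_le_mul_of_nonneg_left (hΨC s a) (show 0 ≤ 1 - χ (s, a) by linarith)
          linarith
      _ = C := by ring
  refine ⟨Ψ', hadm, ?_⟩
  rw [hQJ, hQJ]
  have hvb : (fun p : EuclideanSpace ℝ (Fin ns) × EuclideanSpace ℝ (Fin na) =>
      v p + ((0 : EuclideanSpace ℝ (Fin ns)), d p)) = fun p => (F p.1 p.2, Ψ' p.1 p.2) := by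
    funext p
    simp [hv, hΨ']
  refine himp ε hεpos hε1 (fun p => (0, d p)) (flow Ψ') χ (max KF (KΨ + Kd)) ?_
  exact
    { h0 := h0
      h1 := h1
      hr := hr's.continuous
      hr01 := fun x => hr01 x.1
      fl := hfl Ψ hΨ
      fl' := by rw [hvb]; exact hfl Ψ' hadm
      hv := hvK
      hv' := by rw [hvb]; exact hKF.prodMk hLip
      hK := hK1
      hD := by positivity
      hc := hc
      hε := hεpos
      χc := χ.continuous
      bc := continuous_const.prodMk hds.continuous
      χ0 := fun p => χ.nonneg
      χle := fun p => χ.le_one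
      χ1 := fun p hp => χ.one_of_mem_closedBall (by simpa using hp)
      χz := fun p hp => χ.zero_of_le_dist (by simpa using hp)
      bD := by
        intro p
        have x0 : 0 ≤ χ p := χ.nonneg
        have e : ‖((0 : EuclideanSpace ℝ (Fin ns)), d p)‖ = ‖d p‖ := by
          simp [Prod.norm_def]
        rw [e, hd, norm_smul, Real.norm_of_nonneg x0, mul_comm]
        have : ‖u - Ψ p.1 p.2‖ ≤ 2 * C := by
          have := norm_sub_le u (Ψ p.1 p.2)
          have := hΨC p.1 p.2
          linarith
        exact mul_le_mul_of_nonneg_right this x0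
      bL := by
        intro p
        have x0 : 0 ≤ χ p := χ.nonneg
        rw [hLg, hd, inner_smul_right, mul_comm]
        by_cases hp : ‖p‖ < ε
        · have := hρ (y := p) (by rw [dist_zero_right]; linarith)
          exact mul_le_mul_of_nonneg_left this.le x0
        · have : χ p = 0 := χ.zero_of_le_dist (by simpa using hp)
          simp [this] }
end
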